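/- (Distributional estimate) For every ε > 0 there exist C_ε > 0 and δ₀ > 0 such that for every δ ∈ (0,δ₀), every Lebesgue measurable set E contained in the unit ball B(0,1) ⊂ ℝ³, and every λ ∈ [δ,1]: σ({ξ ∈ S² : (χ_E)*_δ(ξ) ≥ λ}) ≤ C_ε (λ^{-5/2} δ^{-1/2-ε} |E|)^{4/3}. -/

import Mathlib

open MeasureTheory Metric Set
open scoped ENNReal RealInnerProductSpace

noncomputable section

/-- The `δ`-tube centered at `a` in direction `ξ`:
`T^δ_ξ(a) = {x : |(x−a)·ξ| ≤ 1/2, |(x−a) − ((x−a)·ξ)ξ| ≤ δ}`. -/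
def tube (d : ℕ) (δ : ℝ) (ξ a : EuclideanSpace ℝ (Fin d)) : Set (EuclideanSpace ℝ (Fin d)) :=
  {x | abs ⟪x - a, ξ⟫ ≤ 1 / 2 ∧ ‖(x - a) - ⟪x - a, ξ⟫ • ξ‖ ≤ δ}

/-- The Kakeya maximal function `f*_δ(ξ) = sup_a |T^δ_ξ(a)|⁻¹ ∫_{T^δ_ξ(a)} |f|`. -/
def kakeyaMax (d : ℕ) (δ : ℝ) (f : EuclideanSpace ℝ (Fin d) → ℝ)
    (ξ : EuclideanSpace ℝ (Fin d)) : ℝ≥0∞ :=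
  ⨆ a : EuclideanSpace ℝ (Fin d),
    (∫⁻ x in tube d δ ξ a, ENNReal.ofReal |f x|) / volume (tube d δ ξ a)

/-- The surface measure on the unit sphere `S^{d-1} ⊆ ℝ^d`, realized as the
`(d-1)`-dimensional Hausdorff measure restricted to the sphere. -/
def sphereMeasure (d : ℕ) : Measure (EuclideanSpace ℝ (Fin d)) :=
  (μH[(d : ℝ) - 1]).restrict (sphere (0 : EuclideanSpace ℝ (Fin d)) 1)

/-- Model tube: the sup-norm neighbourhood of a line that is a graph over the last coordinate. -/
def MT (a u : ℝ × ℝ) (δ : ℝ) : Set ((ℝ × ℝ) × ℝ) :=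
  {p | ‖p.1 - a - p.2 • u‖ ≤ δ ∧ |p.2| ≤ 1}

lemma MT_meas (a u : ℝ × ℝ) (δ : ℝ) : MeasurableSet (MT a u δ) := by
  have h1 : IsClosed {p : (ℝ × ℝ) × ℝ | ‖p.1 - a - p.2 • u‖ ≤ δ} :=
    isClosed_le (by fun_prop) continuous_const
  have h2 : IsClosed {p : (ℝ × ℝ) × ℝ | |p.2| ≤ 1} :=
    isClosed_le (by fun_prop) continuous_const
  exact (h1.inter h2).measurableSet

lemma vol_ball2 (x : ℝ × ℝ) {r : ℝ} (hr : 0 ≤ r) :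
    volume (closedBall x r) = ENNReal.ofReal (4 * r ^ 2) := by
  have : closedBall x r = closedBall x.1 r ×ˢ closedBall x.2 r := by
    rw [closedBall_prod_same]
  rw [this, Measure.volume_eq_prod, Measure.prod_prod, Real.volume_closedBall,
    Real.volume_closedBall, ← ENNReal.ofReal_mul (by positivity)]
  congr 1; ring

lemma vol_slices {A : Set ((ℝ × ℝ) × ℝ)} (hA : MeasurableSet A) {δ : ℝ} (hδ : 0 ≤ δ)
    (g : ℝ → ℝ × ℝ) {c s : ℝ} (hs : 0 ≤ s)
    (h : ∀ p ∈ A, p.1 ∈ closedBall (g p.2) δ ∧ p.2 ∈ closedBall c s) :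
    volume.real A ≤ 8 * δ ^ 2 * s := by
  have : volume A ≤ ENNReal.ofReal (8 * δ ^ 2 * s) := by
    rw [Measure.volume_eq_prod, Measure.prod_apply_symm hA]
    calc ∫⁻ y, volume ((fun x => (x, y)) ⁻¹' A)
        ≤ ∫⁻ y, (closedBall c s).indicator (fun _ => ENNReal.ofReal (4 * δ ^ 2)) y := by
          apply lintegral_mono
          intro y
          by_cases hy : y ∈ closedBall c s
          · rw [indicator_of_mem hy]
            dsimp only
            rw [← vol_ball2 (g y) hδ]
            exact measure_mono fun x hx => (h (x, y) hx).1
          · rw [indicator_of_notMem hy]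
            have : (fun x => (x, y)) ⁻¹' A = ∅ := by
              ext x
              simp only [mem_preimage, mem_empty_iff_false, iff_false]
              exact fun hx => hy (h (x, y) hx).2
            simp [this]
      _ = ENNReal.ofReal (8 * δ ^ 2 * s) := by
          rw [lintegral_indicator measurableSet_closedBall, setLIntegral_const,
            Real.volume_closedBall, ← ENNReal.ofReal_mul (by positivity)]
          congr 1; ring
  exact ENNReal.toReal_le_of_le_ofReal (by positivity) this

lemma mem_MT_ball {a u : ℝ × ℝ} {δ : ℝ} {p : (ℝ × ℝ) × ℝ} (h : p ∈ MT a u δ) :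
    p.1 ∈ closedBall (a + p.2 • u) δ ∧ p.2 ∈ closedBall (0 : ℝ) 1 := by
  refine ⟨?_, ?_⟩
  · rw [mem_closedBall, dist_eq_norm, ← sub_sub]; exact h.1
  · rw [mem_closedBall, dist_zero_right]; exact h.2

lemma MT_vol (a u : ℝ × ℝ) {δ : ℝ} (hδ : 0 ≤ δ) {A : Set ((ℝ × ℝ) × ℝ)} (hA : MeasurableSet A)
    (h : A ⊆ MT a u δ) : volume.real A ≤ 8 * δ ^ 2 := by
  have := vol_slices hA hδ (fun t => a + t • u) (c := 0) (s := 1) zero_le_one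
    (fun p hp => mem_MT_ball (h hp))
  simpa using this

lemma aux_interval {b v t δ d : ℝ} (h : |b + t * v| ≤ 2 * δ) (hd : 0 < d) (hv : d ≤ |v|) :
    t ∈ closedBall (-b / v) (2 * δ / d) := by
  have hv0 : v ≠ 0 := by rintro rfl; simp at hv; linarith
  rw [mem_closedBall, Real.dist_eq]
  have : t - -b / v = (b + t * v) / v := by field_simp; ring
  rw [this, abs_div]
  have : 0 ≤ 2 * δ := (abs_nonneg _).trans h
  gcongr

lemma MT_inter (a u b v : ℝ × ℝ) {δ d : ℝ} (hδ : 0 ≤ δ) (hd : 0 < d)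
    (hv : d ≤ |u.1 - v.1| ∨ d ≤ |u.2 - v.2|) {A : Set ((ℝ × ℝ) × ℝ)} (hA : MeasurableSet A)
    (h : A ⊆ MT a u δ ∩ MT b v δ) : volume.real A ≤ 16 * δ ^ 3 / d := by
  have key : ∃ c, ∀ p ∈ A, p.2 ∈ closedBall c (2 * δ / d) := by
    rcases hv with hv | hv
    · refine ⟨-(a.1 - b.1) / (u.1 - v.1), fun p hp => aux_interval ?_ hd hv⟩
      have h1 := (norm_fst_le _).trans (h hp).1.1
      have h2 := (norm_fst_le _).trans (h hp).2.1
      simp only [Prod.fst_sub, Prod.smul_fst, smul_eq_mul, Real.norm_eq_abs] at h1 h2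
      rw [abs_le] at *
      constructor <;> nlinarith
    · refine ⟨-(a.2 - b.2) / (u.2 - v.2), fun p hp => aux_interval ?_ hd hv⟩
      have h1 := (norm_snd_le _).trans (h hp).1.1
      have h2 := (norm_snd_le _).trans (h hp).2.1
      simp only [Prod.snd_sub, Prod.smul_snd, smul_eq_mul, Real.norm_eq_abs] at h1 h2
      rw [abs_le] at *
      constructor <;> nlinarith
  obtain ⟨c, hc⟩ := key
  have := vol_slices hA hδ (fun t => a + t • u) (c := c) (s := 2 * δ / d) (by positivity)
    (fun p hp => ⟨(mem_MT_ball (h hp).1).1, hc p hp⟩)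
  refine this.trans (le_of_eq ?_)
  ring

/-- rescaling used for narrow caps -/
lemma vol_narrow {A : Set ((ℝ × ℝ) × ℝ)} (hA : MeasurableSet A) {ρ : ℝ} (hρ : 0 < ρ)
    (u₀ : ℝ × ℝ) :
    volume ((fun p : (ℝ × ℝ) × ℝ => (ρ • p.1 + p.2 • u₀, p.2)) ⁻¹' A)
      = ENNReal.ofReal (ρ ^ 2)⁻¹ * volume A := by
  have hm : Measurable (fun p : (ℝ × ℝ) × ℝ => (ρ • p.1 + p.2 • u₀, p.2)) := by fun_prop
  rw [Measure.volume_eq_prod, Measure.prod_apply_symm (hm hA), Measure.prod_apply_symm hA,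
    ← lintegral_const_mul _ (measurable_measure_prodMk_right hA)]
  congr 1
  ext y
  have : (fun x => (x, y)) ⁻¹' ((fun p : (ℝ × ℝ) × ℝ => (ρ • p.1 + p.2 • u₀, p.2)) ⁻¹' A)
     = (fun x => ρ • x) ⁻¹' ((fun x => x + y • u₀) ⁻¹' ((fun x => (x, y)) ⁻¹' A)) := rfl
  rw [this, Measure.addHaar_preimage_smul _ hρ.ne', measure_preimage_add_right]
  have : Module.finrank ℝ (ℝ × ℝ) = 2 := by simp
  rw [this, abs_of_pos (by positivity)]

lemma vol_conc {A : Set ((ℝ × ℝ) × ℝ)} {ρ : ℝ} (hρ : 0 < ρ) (z : ℝ) :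
    volume ((fun p : (ℝ × ℝ) × ℝ => (ρ • p.1, ρ * p.2 + z)) ⁻¹' A)
      = ENNReal.ofReal (ρ ^ 3)⁻¹ * volume A := by
  have : (fun p : (ℝ × ℝ) × ℝ => (ρ • p.1, ρ * p.2 + z)) ⁻¹' A
     = (fun x => ρ • x) ⁻¹' ((fun x => x + ((0, z) : (ℝ × ℝ) × ℝ)) ⁻¹' A) := by
    ext p
    have : (ρ • p.1, ρ * p.2 + z) = ρ • p + ((0, z) : (ℝ × ℝ) × ℝ) := by
      ext <;> simp
    simp only [mem_preimage, this]
  have hH : (volume : Measure ((ℝ × ℝ) × ℝ)).IsAddHaarMeasure :=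
    Measure.prod.instIsAddHaarMeasure _ _
  have hf : Module.finrank ℝ ((ℝ × ℝ) × ℝ) = 3 := by simp
  rw [this, Measure.addHaar_preimage_smul _ hρ.ne', measure_preimage_add_right, hf,
    abs_of_pos (by positivity)]

lemma MT_narrow (a u u₀ : ℝ × ℝ) {δ ρ : ℝ} (hρ : 0 < ρ) :
    (fun p : (ℝ × ℝ) × ℝ => (ρ • p.1 + p.2 • u₀, p.2)) ⁻¹' (MT a u δ)
      = MT (ρ⁻¹ • a) (ρ⁻¹ • (u - u₀)) (δ / ρ) := by
  ext p
  simp only [MT, mem_preimage, mem_ofPred_eq]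
  have : ρ • p.1 + p.2 • u₀ - a - p.2 • u
      = ρ • (p.1 - ρ⁻¹ • a - p.2 • (ρ⁻¹ • (u - u₀))) := by
    ext <;> simp <;> field_simp <;> ring
  rw [this, norm_smul, Real.norm_of_nonneg hρ.le, le_div_iff₀ hρ, mul_comm]

lemma MT_conc (a u : ℝ × ℝ) {δ ρ : ℝ} (hρ : 0 < ρ) (z : ℝ) :
    (fun p : (ℝ × ℝ) × ℝ => (ρ • p.1, ρ * p.2 + z)) ⁻¹' (MT a u δ ∩ {p | |p.2 - z| ≤ ρ})
      ⊆ MT (ρ⁻¹ • (a + z • u)) u (δ / ρ) := by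
  intro p hp
  simp only [MT, mem_preimage, mem_ofPred_eq, mem_inter_iff] at hp ⊢
  obtain ⟨⟨h1, -⟩, h2⟩ := hp
  have : ρ • p.1 - a - (ρ * p.2 + z) • u
      = ρ • (p.1 - ρ⁻¹ • (a + z • u) - p.2 • u) := by
    ext <;> simp <;> field_simp <;> ring
  rw [this, norm_smul, Real.norm_of_nonneg hρ.le] at h1
  refine ⟨by rw [le_div_iff₀ hρ, mul_comm]; exact h1, ?_⟩
  rw [add_sub_cancel_right, abs_mul, abs_of_pos hρ] at h2
  nlinarith


lemma sum_le_inj {α β : Type*} [DecidableEq β] (S : Finset α) (T : Finset β) (φ : α → β)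
    (hφ : Set.InjOn φ S) (hm : ∀ i ∈ S, φ i ∈ T) (F : β → ℝ) (hF : ∀ b, 0 ≤ F b) :
    ∑ i ∈ S, F (φ i) ≤ ∑ b ∈ T, F b := by
  rw [← Finset.sum_image hφ]
  apply Finset.sum_le_sum_of_subset_of_nonneg
  · intro b hb
    obtain ⟨i, hi, rfl⟩ := Finset.mem_image.1 hb
    exact hm i hi
  · intros; exact hF _

lemma floor_close {x y d : ℝ} (hd : 0 < d) (h : ⌊x / d⌋ = ⌊y / d⌋) : |x - y| < d := by
  have h1 := Int.abs_sub_lt_one_of_floor_eq_floor h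
  rw [← sub_div, abs_div, abs_of_pos hd, div_lt_one hd] at h1
  exact h1

lemma floor_card {x : ℝ} (hx : 0 ≤ x) : (((Finset.Icc ⌊-x⌋ ⌊x⌋).card : ℕ) : ℝ) ≤ 2 * x + 2 := by
  rw [Int.card_Icc]
  have h1 : ⌊-x⌋ ≤ ⌊x⌋ := Int.floor_mono (by linarith)
  have h2 : (((⌊x⌋ + 1 - ⌊-x⌋).toNat : ℕ) : ℝ) = ((⌊x⌋ + 1 - ⌊-x⌋ : ℤ) : ℝ) := by
    have : (((⌊x⌋ + 1 - ⌊-x⌋).toNat : ℕ) : ℤ) = (⌊x⌋ + 1 - ⌊-x⌋ : ℤ) :=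
      Int.toNat_of_nonneg (by linarith)
    exact_mod_cast this
  rw [h2]
  push_cast
  have := Int.floor_le x
  have := Int.lt_floor_add_one (-x)
  linarith

lemma floor_mem {x R : ℝ} (h : |x| ≤ R) : ⌊x⌋ ∈ Finset.Icc ⌊-R⌋ ⌊R⌋ := by
  rw [Finset.mem_Icc]
  rw [abs_le] at h
  exact ⟨Int.floor_mono h.1, Int.floor_mono h.2⟩

/-- `δ`-separation of the slopes indexed by `S`. -/
def SlopeSep {ι : Type*} (S : Finset ι) (u : ι → ℝ × ℝ) (δ : ℝ) : Prop :=
  ∀ i ∈ S, ∀ j ∈ S, i ≠ j → δ ≤ ‖u i - u j‖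

lemma SlopeSep.mono {ι : Type*} {S T : Finset ι} {u : ι → ℝ × ℝ} {δ : ℝ} (h : SlopeSep T u δ)
    (hST : S ⊆ T) : SlopeSep S u δ := fun i hi j hj => h i (hST hi) j (hST hj)

lemma sep_count {ι : Type*} {S : Finset ι} {u : ι → ℝ × ℝ} {δ : ℝ} (hδ : 0 < δ)
    (hs : SlopeSep S u δ) (u₀ : ℝ × ℝ) {R : ℝ} (hR : 0 ≤ R) (h : ∀ i ∈ S, ‖u i - u₀‖ ≤ R) :
    (S.card : ℝ) ≤ (2 * R / δ + 2) ^ 2 := by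
  classical
  set T := (Finset.Icc ⌊-(R / δ)⌋ ⌊R / δ⌋) ×ˢ (Finset.Icc ⌊-(R / δ)⌋ ⌊R / δ⌋) with hT
  have := sum_le_inj S T (fun i => (⌊((u i).1 - u₀.1) / δ⌋, ⌊((u i).2 - u₀.2) / δ⌋))
    (by
      intro i hi j hj hij
      by_contra hne
      have h1 := hs i hi j hj hne
      simp only [Prod.mk.injEq] at hij
      have h2 := floor_close hδ hij.1
      have h3 := floor_close hδ hij.2
      rw [sub_sub_sub_cancel_right] at h2 h3
      have : ‖u i - u j‖ < δ := by
        rw [Prod.norm_def]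
        exact max_lt h2 h3
      linarith)
    (by
      intro i hi
      have h1 := h i hi
      have h2 := (norm_fst_le _).trans h1
      have h3 := (norm_snd_le _).trans h1
      simp only [Prod.fst_sub, Prod.snd_sub, Real.norm_eq_abs] at h2 h3
      rw [hT, Finset.mem_product]
      constructor
      · apply floor_mem
        rw [abs_div, abs_of_pos hδ]; gcongr
      · apply floor_mem
        rw [abs_div, abs_of_pos hδ]; gcongr)
    (fun _ => 1) (fun _ => zero_le_one)
  simp only [Finset.sum_const, nsmul_eq_mul, mul_one] at this
  refine this.trans ?_
  rw [hT, Finset.card_product]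
  push_cast
  have hc := floor_card (x := R / δ) (by positivity)
  rw [sq]
  have : 2 * R / δ + 2 = 2 * (R / δ) + 2 := by ring
  rw [this]
  gcongr

lemma exists_max_sep {ι : Type*} (Ω : Set ι) (u : ι → ℝ × ℝ) {δ : ℝ} (hδ : 0 < δ) (N : ℕ)
    (hN : ∀ S : Finset ι, ↑S ⊆ Ω → SlopeSep S u δ → S.card ≤ N) :
    ∃ S : Finset ι, ↑S ⊆ Ω ∧ SlopeSep S u δ ∧ ∀ x ∈ Ω, ∃ i ∈ S, ‖u x - u i‖ < δ := by
  classical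
  let P : ℕ → Prop := fun n => ∃ S : Finset ι, ↑S ⊆ Ω ∧ SlopeSep S u δ ∧ S.card = n
  have hP0 : P 0 := ⟨∅, by simp, by intro i hi; simp at hi, rfl⟩
  obtain ⟨S, h1, h2, h3⟩ := Nat.findGreatest_spec (P := P) (Nat.zero_le N) hP0
  refine ⟨S, h1, h2, ?_⟩
  intro x hx
  by_contra hcon
  push Not at hcon
  have hxS : x ∉ S := fun hxS => by
    have := hcon x hxS
    simp at this; linarith
  have h4 : ↑(insert x S) ⊆ Ω := by
    rw [Finset.coe_insert]; exact Set.insert_subset hx h1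
  have h5 : SlopeSep (insert x S) u δ := by
    intro i hi j hj hij
    rw [Finset.mem_insert] at hi hj
    rcases hi with rfl | hi <;> rcases hj with rfl | hj
    · exact absurd rfl hij
    · exact hcon j hj
    · rw [norm_sub_rev]; exact hcon i hi
    · exact h2 i hi j hj hij
  have h6 : P (S.card + 1) := ⟨insert x S, h4, h5, Finset.card_insert_of_notMem hxS⟩
  have h7 : S.card + 1 ≤ N := by
    have := hN _ h4 h5
    rwa [Finset.card_insert_of_notMem hxS] at this
  have := Nat.le_findGreatest h7 h6
  omega

lemma int_sum (M : ℕ) : ∑ k ∈ Finset.Icc (-(M : ℤ)) M, (1 : ℝ) / (|(k : ℝ)| + 1)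
    ≤ 2 * (1 + Real.log (M + 1)) := by
  classical
  have h := sum_le_inj (Finset.Icc (-(M : ℤ)) M) (Finset.range (M + 1) ×ˢ (Finset.univ : Finset Bool))
    (fun k => (k.natAbs, decide (k < 0)))
    (by
      intro k _ l _ hkl
      simp only [Prod.mk.injEq, decide_eq_decide] at hkl
      omega)
    (by
      intro k hk
      rw [Finset.mem_Icc] at hk
      simp only [Finset.mem_product, Finset.mem_range, Finset.mem_univ, and_true]
      omega)
    (fun x => (1 : ℝ) / ((x.1 : ℝ) + 1)) (fun x => by positivity)
  have h2 : ∀ k : ℤ, ((k.natAbs : ℕ) : ℝ) = |(k : ℝ)| := fun k => by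
    rw [Nat.cast_natAbs]; simp
  simp only [h2] at h
  refine h.trans ?_
  rw [Finset.sum_product]
  simp only [Finset.sum_const, Finset.card_univ, Fintype.card_bool, nsmul_eq_mul]
  rw [← Finset.mul_sum]
  have h3 := harmonic_le_one_add_log (M + 1)
  rw [harmonic] at h3
  push_cast at h3
  simp only [one_div]
  push_cast
  linarith

lemma strip_sum {ι : Type*} {S : Finset ι} {v : ι → ℝ × ℝ} {δ θ W : ℝ} (hδ : 0 < δ) (hδ1 : δ ≤ 1)
    (hθ : 0 < θ) (hW : 0 ≤ W) (hs : SlopeSep S v δ) (v₀ : ℝ × ℝ) (hθv : θ ≤ |v₀.1|)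
    (hdom : |v₀.2| ≤ |v₀.1|)
    (hb : ∀ i ∈ S, |(v i).1 - v₀.1| ≤ 4)
    (hstrip : ∀ i ∈ S, |v₀.1 * (v i).2 - v₀.2 * (v i).1| ≤ W * δ)
    (g : ι → ℝ) (hg1 : ∀ i ∈ S, g i ≤ 8 * δ ^ 2)
    (hg2 : ∀ i ∈ S, ∀ d > 0, d ≤ |(v i).1 - v₀.1| → g i ≤ 16 * δ ^ 3 / d) :
    ∑ i ∈ S, g i ≤ (4 * W / θ + 2) * (192 * δ ^ 2 * (1 + Real.log (10 / δ))) := by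
  classical
  have hv0 : v₀.1 ≠ 0 := by intro h; rw [h] at hθv; simp at hθv; linarith
  set q := v₀.2 / v₀.1 with hq
  have hq1 : |q| ≤ 1 := by
    rw [hq, abs_div, div_le_one (abs_pos.2 hv0)]; exact hdom
  have hd2 : 0 < δ / 2 := by positivity
  set M := ⌈8 / δ⌉₊ with hM
  have hMle : 8 / δ ≤ M := Nat.le_ceil _
  let φ : ι → ℤ × ℤ := fun i =>
    (⌊((v i).1 - v₀.1) / (δ / 2)⌋, ⌊((v i).2 - q * (v i).1) / (δ / 2)⌋)
  let F : ℤ × ℤ → ℝ := fun x => 96 * δ ^ 2 * (1 / (|(x.1 : ℝ)| + 1))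
  have hgF : ∀ i ∈ S, g i ≤ F (φ i) := by
    intro i hi
    set k := ⌊((v i).1 - v₀.1) / (δ / 2)⌋ with hk
    show g i ≤ 96 * δ ^ 2 * (1 / (|(k : ℝ)| + 1))
    have hk1 : (k : ℝ) ≤ ((v i).1 - v₀.1) / (δ / 2) := Int.floor_le _
    have hk2 : ((v i).1 - v₀.1) / (δ / 2) < k + 1 := Int.lt_floor_add_one _
    rw [le_div_iff₀ hd2] at hk1
    rw [div_lt_iff₀ hd2] at hk2
    have hfin : ∀ d > 0, d ≤ |(v i).1 - v₀.1| → (|(k : ℝ)| + 1) * δ / 6 ≤ d →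
        g i ≤ 96 * δ ^ 2 * (1 / (|(k : ℝ)| + 1)) := by
      intro d hd h1 h2
      refine (hg2 i hi d hd h1).trans ?_
      have hp : 0 < |(k : ℝ)| + 1 := by positivity
      have : 96 * δ ^ 2 * (1 / (|(k : ℝ)| + 1)) = 16 * δ ^ 3 / ((|(k : ℝ)| + 1) * δ / 6) := by
        field_simp; ring
      rw [this]
      gcongr
    rcases le_or_gt 1 k with h1 | h1
    · have h1' : (1 : ℝ) ≤ k := by exact_mod_cast h1
      apply hfin (k * (δ / 2)) (by positivity) (hk1.trans (le_abs_self _))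
      rw [abs_of_nonneg (by linarith)]
      nlinarith
    · rcases le_or_gt k (-2) with h2 | h2
      · have h2' : (k : ℝ) ≤ -2 := by exact_mod_cast h2
        have h3 : 0 < (-(k : ℝ) - 1) * (δ / 2) := by
          apply mul_pos <;> linarith
        apply hfin _ h3
        · rw [le_abs]; right; linarith
        · rw [abs_of_nonpos (by linarith)]
          nlinarith
      · have h3 : |(k : ℝ)| ≤ 1 := by
          rw [abs_le]
          constructor
          · have : -1 ≤ k := by omega
            exact_mod_cast this
          · have : k ≤ 1 := by omega
            exact_mod_cast this
        refine (hg1 i hi).trans ?_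
        have : (1 : ℝ) / 2 ≤ 1 / (|(k : ℝ)| + 1) := by
          apply one_div_le_one_div_of_le (by positivity); linarith
        nlinarith [sq_nonneg δ]
  refine (Finset.sum_le_sum hgF).trans ?_
  have h1 := sum_le_inj S
    (Finset.Icc (-(M : ℤ)) M ×ˢ Finset.Icc ⌊-(2 * W / θ)⌋ ⌊2 * W / θ⌋) φ
    (by
      intro i hi j hj hij
      by_contra hne
      have h1 := hs i hi j hj hne
      simp only [φ, Prod.mk.injEq] at hij
      have h2 := floor_close hd2 hij.1
      have h3 := floor_close hd2 hij.2
      rw [sub_sub_sub_cancel_right] at h2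
      have h4 : |(v i).2 - (v j).2| < δ := by
        have e : (v i).2 - (v j).2 = ((v i).2 - q * (v i).1 - ((v j).2 - q * (v j).1))
          + q * ((v i).1 - (v j).1) := by ring
        rw [e]
        refine (abs_add_le _ _).trans_lt ?_
        rw [abs_mul]
        have : |q| * |(v i).1 - (v j).1| ≤ 1 * |(v i).1 - (v j).1| := by gcongr
        linarith
      have : ‖v i - v j‖ < δ := by
        rw [Prod.norm_def]
        exact max_lt (by simp only [Prod.fst_sub, Real.norm_eq_abs]; linarith) h4
      linarith)
    (by
      intro i hi
      rw [Finset.mem_product]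
      constructor
      · have h1 := hb i hi
        have h2 : |((v i).1 - v₀.1) / (δ / 2)| ≤ M := by
          refine le_trans ?_ hMle
          rw [abs_div, abs_of_pos hd2, div_le_div_iff₀ hd2 hδ]
          nlinarith
        rw [abs_le] at h2
        rw [Finset.mem_Icc]
        constructor
        · apply Int.le_floor.2; push_cast; exact h2.1
        · have : ((⌊((v i).1 - v₀.1) / (δ / 2)⌋ : ℤ) : ℝ) ≤ M := (Int.floor_le _).trans h2.2
          exact_mod_cast this
      · apply floor_mem
        rw [abs_div, abs_of_pos hd2, div_le_div_iff₀ hd2 hθ]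
        have e : (v i).2 - q * (v i).1 = (v₀.1 * (v i).2 - v₀.2 * (v i).1) / v₀.1 := by
          rw [hq]; field_simp
        rw [e, abs_div]
        have h2 := hstrip i hi
        have hp : 0 < |v₀.1| := abs_pos.2 hv0
        rw [div_mul_eq_mul_div, div_le_iff₀ hp]
        nlinarith [mul_nonneg hW hδ.le])
    F (fun b => by positivity)
  refine h1.trans ?_
  rw [Finset.sum_product]
  simp only [F, Finset.sum_const, nsmul_eq_mul]
  rw [← Finset.mul_sum, ← Finset.mul_sum]
  have hc := floor_card (x := 2 * W / θ) (by positivity)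
  have hi := int_sum M
  have hlog : Real.log (M + 1) ≤ Real.log (10 / δ) := by
    apply Real.log_le_log (by positivity)
    have : (M : ℝ) < 8 / δ + 1 := Nat.ceil_lt_add_one (by positivity)
    have h2 : (1 : ℝ) ≤ 1 / δ := by rw [le_div_iff₀ hδ]; linarith
    have h3 : 10 / δ = 8 / δ + 1 / δ + 1 / δ := by ring
    linarith
  have e : (4 * W / θ + 2) * (192 * δ ^ 2 * (1 + Real.log (10 / δ)))
    = (2 * (2 * W / θ) + 2) * (96 * δ ^ 2 * (2 * (1 + Real.log (10 / δ)))) := by ring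
  rw [e]
  have h0 : 0 ≤ ∑ k ∈ Finset.Icc (-(M : ℤ)) M, (1 : ℝ) / (|(k : ℝ)| + 1) :=
    Finset.sum_nonneg fun k _ => by positivity
  gcongr
  linarith


lemma cs_int {α : Type*} [MeasurableSpace α] (μ : Measure α) [IsFiniteMeasure μ] (f : α → ℝ)
    (hf : Integrable f μ) (hf2 : Integrable (fun x => f x ^ 2) μ) :
    (∫ x, f x ∂μ) ^ 2 ≤ μ.real univ * ∫ x, f x ^ 2 ∂μ := by
  set A := ∫ x, f x ∂μ with hA
  set B := ∫ x, f x ^ 2 ∂μ with hB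
  set m := μ.real univ with hm
  have hB0 : 0 ≤ B := integral_nonneg fun x => sq_nonneg _
  have key : ∀ t : ℝ, 0 ≤ B - 2 * t * A + t ^ 2 * m := by
    intro t
    have h0 : 0 ≤ ∫ x, (f x - t) ^ 2 ∂μ := integral_nonneg fun x => sq_nonneg _
    have e : ∫ x, (f x - t) ^ 2 ∂μ = ∫ x, (f x ^ 2 - 2 * t * f x + t ^ 2) ∂μ := by
      congr 1; ext x; ring
    have i1 : Integrable (fun x => f x ^ 2 - 2 * t * f x) μ := hf2.sub (hf.const_mul _)
    rw [e, integral_add i1 (integrable_const _),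
      integral_sub hf2 (hf.const_mul _), integral_const_mul, integral_const] at h0
    simp only [smul_eq_mul] at h0
    rw [← hA, ← hB, ← hm] at h0
    linarith
  have hm0 : 0 ≤ m := measureReal_nonneg
  rcases hm0.eq_or_lt with h | h
  · have hz : μ = 0 := by
      rw [hm] at h
      have := (measureReal_eq_zero_iff (μ := μ) (s := univ)).1 h.symm
      simpa using this
    have : A = 0 := by rw [hA, hz]; simp
    rw [this, ← h]; simp
  · have := key (A / m)
    have e : B - 2 * (A / m) * A + (A / m) ^ 2 * m = B - A ^ 2 / m := by field_simp; ring
    rw [e] at this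
    have h2 : A ^ 2 / m ≤ B := by linarith
    rw [div_le_iff₀ h] at h2
    linarith

lemma int_ind {α : Type*} [MeasurableSpace α] (μ : Measure α) [IsFiniteMeasure μ] {T : Set α}
    (hT : MeasurableSet T) : Integrable (T.indicator (fun _ => (1 : ℝ))) μ :=
  (integrable_const (1 : ℝ)).indicator hT

lemma ind_mul {α : Type*} (S T : Set α) (x : α) :
    S.indicator (fun _ => (1 : ℝ)) x * T.indicator (fun _ => (1 : ℝ)) x
      = (S ∩ T).indicator (fun _ => (1 : ℝ)) x := by
  by_cases h1 : x ∈ S <;> by_cases h2 : x ∈ T <;> simp [h1, h2]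

/-- weighted counting function -/
def cnt {ι α : Type*} (I : Finset ι) (w : ι → ℝ) (T : ι → Set α) (x : α) : ℝ :=
  ∑ i ∈ I, w i * (T i).indicator (fun _ => (1 : ℝ)) x

lemma cnt_nonneg {ι α : Type*} (I : Finset ι) {w : ι → ℝ} (hw : ∀ i, 0 ≤ w i) (T : ι → Set α)
    (x : α) : 0 ≤ cnt I w T x :=
  Finset.sum_nonneg fun i _ => mul_nonneg (hw i) (indicator_nonneg (fun _ _ => zero_le_one) _)

lemma cnt_integrable {ι α : Type*} [MeasurableSpace α] (μ : Measure α) [IsFiniteMeasure μ]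
    (I : Finset ι) (w : ι → ℝ) {T : ι → Set α} (hT : ∀ i, MeasurableSet (T i)) :
    Integrable (cnt I w T) μ :=
  integrable_finsetSum _ fun i _ => (int_ind μ (hT i)).const_mul _

lemma cnt_measurable {ι α : Type*} [MeasurableSpace α]
    (I : Finset ι) (w : ι → ℝ) {T : ι → Set α} (hT : ∀ i, MeasurableSet (T i)) :
    Measurable (cnt I w T) :=
  Finset.measurable_sum _ fun i _ => (measurable_const.indicator (hT i)).const_mul _

lemma cnt_integral {ι α : Type*} [MeasurableSpace α] (μ : Measure α) [IsFiniteMeasure μ]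
    (I : Finset ι) (w : ι → ℝ) {T : ι → Set α} (hT : ∀ i, MeasurableSet (T i)) :
    ∫ x, cnt I w T x ∂μ = ∑ i ∈ I, w i * μ.real (T i) := by
  unfold cnt
  rw [integral_finsetSum _ fun i _ => (int_ind μ (hT i)).const_mul _]
  apply Finset.sum_congr rfl
  intro i _
  rw [integral_const_mul, integral_indicator (hT i)]
  simp

lemma cnt_sq {ι α : Type*} (I : Finset ι) (w : ι → ℝ) (T : ι → Set α) (x : α) :
    cnt I w T x ^ 2
      = cnt (I ×ˢ I) (fun q => w q.1 * w q.2) (fun q => T q.1 ∩ T q.2) x := by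
  unfold cnt
  rw [sq, Finset.sum_mul_sum, Finset.sum_product]
  apply Finset.sum_congr rfl; intro i _
  apply Finset.sum_congr rfl; intro j _
  rw [← ind_mul]; ring

lemma cs_sets {ι α : Type*} [MeasurableSpace α] (μ : Measure α) {E : Set α}
    (hEf : μ E ≠ ⊤) (I : Finset ι) {Y : ι → Set α} (hY : ∀ i, MeasurableSet (Y i))
    (hYE : ∀ i, Y i ⊆ E) :
    (∑ i ∈ I, μ.real (Y i)) ^ 2
      ≤ μ.real E * ∑ i ∈ I, ∑ j ∈ I, μ.real (Y i ∩ Y j) := by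
  have : Fact (μ E < ⊤) := ⟨hEf.lt_top⟩
  have h := cs_int (μ.restrict E) (cnt I (fun _ => 1) Y) (cnt_integrable _ _ _ hY)
    (by
      simp only [cnt_sq]
      exact cnt_integrable _ _ _ fun q => (hY q.1).inter (hY q.2))
  simp only [cnt_sq] at h
  rw [cnt_integral _ _ _ hY,
    cnt_integral _ _ _ (T := fun q : ι × ι => Y q.1 ∩ Y q.2)
      (fun q => (hY q.1).inter (hY q.2))] at h
  rw [Finset.sum_product] at h
  simp only [one_mul, measureReal_restrict_apply_univ] at h
  have e1 : ∀ i, (μ.restrict E).real (Y i) = μ.real (Y i) := fun i => by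
    rw [measureReal_restrict_apply (hY i), inter_eq_left.2 (hYE i)]
  have e2 : ∀ i j, (μ.restrict E).real (Y i ∩ Y j) = μ.real (Y i ∩ Y j) := fun i j => by
    rw [measureReal_restrict_apply ((hY i).inter (hY j)),
      inter_eq_left.2 (inter_subset_left.trans (hYE i))]
  simpa only [e1, e2] using h

lemma wedge_bound {v v' e : ℝ × ℝ} {s s' δ ρ : ℝ} (hρ : 0 < ρ)
    (hs' : ρ / 2 < |s'|) (hv : ‖v‖ ≤ 2)
    (he : ‖e‖ ≤ 6 * δ) (h : s' • v' = s • v + e) :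
    |v.1 * v'.2 - v.2 * v'.1| ≤ 48 / ρ * δ := by
  have h1 := congrArg Prod.fst h
  have h2 := congrArg Prod.snd h
  simp only [Prod.smul_fst, Prod.smul_snd, Prod.fst_add, Prod.snd_add, smul_eq_mul] at h1 h2
  have hv1 := (norm_fst_le _).trans hv
  have hv2 := (norm_snd_le _).trans hv
  have he1 := (norm_fst_le _).trans he
  have he2 := (norm_snd_le _).trans he
  rw [Real.norm_eq_abs] at hv1 hv2 he1 he2
  have e1 : s' * (v.1 * v'.2 - v.2 * v'.1) = v.1 * e.2 - v.2 * e.1 := by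
    linear_combination v.1 * h2 - v.2 * h1
  have hδ : 0 ≤ 6 * δ := (norm_nonneg _).trans he
  have h3 : |s'| * |v.1 * v'.2 - v.2 * v'.1| ≤ 24 * δ := by
    rw [← abs_mul, e1]
    refine (abs_sub _ _).trans ?_
    rw [abs_mul, abs_mul]
    have : |v.1| * |e.2| ≤ 2 * (6 * δ) := by gcongr
    have : |v.2| * |e.1| ≤ 2 * (6 * δ) := by gcongr
    linarith
  have h4 : ρ / 2 * |v.1 * v'.2 - v.2 * v'.1| ≤ 24 * δ := by
    refine le_trans ?_ h3
    gcongr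
  have e5 : 48 / ρ * δ = 24 * δ / (ρ / 2) := by field_simp; ring
  rw [e5, le_div_iff₀ (by positivity)]
  linarith

lemma hairbrush {ι : Type*} (H : Finset ι) (a u : ι → ℝ × ℝ) {δ ρ lam : ℝ} (hδ : 0 < δ)
    (hδ1 : δ ≤ 1) (hρ : 0 < ρ) (hρ1 : ρ ≤ 1) (hlam : 0 < lam) (hu : ∀ i ∈ H, ‖u i‖ ≤ 1)
    (hsep : SlopeSep H u δ)
    {E : Set ((ℝ × ℝ) × ℝ)} (hE : MeasurableSet E) (hEf : volume E ≠ ⊤)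
    (hnc : ∀ i ∈ H, ∀ t₀ : ℝ,
      lam * δ ^ 2 / 2 ≤ volume.real (MT (a i) (u i) δ ∩ E ∩ {p | ρ / 2 < |p.2 - t₀|}))
    (b w : ℝ × ℝ) (hw : ‖w‖ ≤ 1) (hHw : ∀ i ∈ H, ρ ≤ ‖u i - w‖)
    (hHT : ∀ i ∈ H, (MT (a i) (u i) δ ∩ MT b w δ).Nonempty) :
    (H.card : ℝ) * (lam ^ 2 * δ ^ 2)
      ≤ 160000 / ρ ^ 2 * (1 + Real.log (10 / δ)) * volume.real E := by
  classical
  set L := 1 + Real.log (10 / δ) with hL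
  have hL0 : 0 ≤ L := by
    have : 0 ≤ Real.log (10 / δ) := Real.log_nonneg (by rw [le_div_iff₀ hδ]; linarith)
    linarith
  choose! P hP using hHT
  let Y : ι → Set ((ℝ × ℝ) × ℝ) := fun i =>
    MT (a i) (u i) δ ∩ E ∩ {p | ρ / 2 < |p.2 - (P i).2|}
  have hYm : ∀ i, MeasurableSet (Y i) := fun i =>
    ((MT_meas _ _ _).inter hE).inter (measurableSet_lt measurable_const (by fun_prop))
  have hYE : ∀ i, Y i ⊆ E := fun i p hp => hp.1.2
  have hYT : ∀ i, Y i ⊆ MT (a i) (u i) δ := fun i p hp => hp.1.1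
  have hcs := cs_sets volume hEf H hYm hYE
  have hlow : (H.card : ℝ) * (lam * δ ^ 2 / 2) ≤ ∑ i ∈ H, volume.real (Y i) := by
    rw [← nsmul_eq_mul]
    exact Finset.card_nsmul_le_sum _ _ _ fun i hi => hnc i hi _
  let v : ι → ℝ × ℝ := fun i => u i - w
  have hv2 : ∀ i ∈ H, ‖v i‖ ≤ 2 := fun i hi => by
    refine (norm_sub_le _ _).trans ?_
    linarith [hu i hi]
  have hrel : ∀ i ∈ H, ∀ p ∈ Y i, ‖(p.1 - b - p.2 • w) - (p.2 - (P i).2) • v i‖ ≤ 3 * δ := by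
    intro i hi p hp
    have h1 := (hP i hi).1.1
    have h2 := (hP i hi).2.1
    have h3 := (hYT i hp).1
    have e : (p.1 - b - p.2 • w) - (p.2 - (P i).2) • v i
      = (p.1 - a i - p.2 • u i) - ((P i).1 - a i - (P i).2 • u i)
        + ((P i).1 - b - (P i).2 • w) := by
      ext <;> simp [v] <;> ring
    rw [e]
    refine (norm_add_le _ _).trans ?_
    have := norm_sub_le (p.1 - a i - p.2 • u i) ((P i).1 - a i - (P i).2 • u i)
    linarith
  have hwedge : ∀ i ∈ H, ∀ j ∈ H, (Y i ∩ Y j).Nonempty →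
      |(v i).1 * (v j).2 - (v i).2 * (v j).1| ≤ 48 / ρ * δ := by
    rintro i hi j hj ⟨p, hpi, hpj⟩
    apply wedge_bound (s := p.2 - (P i).2) (s' := p.2 - (P j).2) hρ hpj.2 (hv2 i hi)
      (e := (p.2 - (P j).2) • v j - (p.2 - (P i).2) • v i) _ (by abel)
    have h1 := hrel i hi p hpi
    have h2 := hrel j hj p hpj
    have e : (p.2 - (P j).2) • v j - (p.2 - (P i).2) • v i
      = ((p.1 - b - p.2 • w) - (p.2 - (P i).2) • v i)
        - ((p.1 - b - p.2 • w) - (p.2 - (P j).2) • v j) := by abel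
    rw [e]
    refine (norm_sub_le _ _).trans ?_
    linarith
  have hrow : ∀ i ∈ H, ∑ j ∈ H, volume.real (Y i ∩ Y j) ≤ 40000 / ρ ^ 2 * δ ^ 2 * L := by
    intro i hi
    let S := H.filter fun j => (Y i ∩ Y j).Nonempty
    have hS : ∑ j ∈ H, volume.real (Y i ∩ Y j) = ∑ j ∈ S, volume.real (Y i ∩ Y j) := by
      symm
      apply Finset.sum_subset (Finset.filter_subset _ _)
      intro j hj hjS
      have : Y i ∩ Y j = ∅ := by
        rw [← Set.not_nonempty_iff_eq_empty]
        intro hne; exact hjS (Finset.mem_filter.2 ⟨hj, hne⟩)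
      simp [this]
    have hSH : ∀ j ∈ S, j ∈ H := fun j hj => (Finset.mem_filter.1 hj).1
    have hdiff : ∀ j, v j - v i = u j - u i := fun j => by simp [v]
    have hdist : ∀ j ∈ S, ‖v j - v i‖ ≤ 4 := fun j hj => by
      refine (norm_sub_le _ _).trans ?_
      linarith [hv2 j (hSH j hj), hv2 i hi]
    have hIntegr : ∀ j ∈ S, ∀ d > 0, (d ≤ |(v j).1 - (v i).1| ∨ d ≤ |(v j).2 - (v i).2|) →
        volume.real (Y i ∩ Y j) ≤ 16 * δ ^ 3 / d := by
      intro j hj d hd h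
      apply MT_inter (a j) (u j) (a i) (u i) hδ.le hd _ ((hYm i).inter (hYm j))
      · intro p hp; exact ⟨hYT j hp.2, hYT i hp.1⟩
      · simpa [v] using h
    have h8 : ∀ j ∈ S, volume.real (Y i ∩ Y j) ≤ 8 * δ ^ 2 := fun j hj =>
      MT_vol (a i) (u i) hδ.le ((hYm i).inter (hYm j)) (inter_subset_left.trans (hYT i))
    have hfin : (4 * (48 / ρ) / ρ + 2) * (192 * δ ^ 2 * L) ≤ 40000 / ρ ^ 2 * δ ^ 2 * L := by
      have h1 : (4 * (48 / ρ) / ρ + 2) ≤ 194 / ρ ^ 2 := by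
        have : 2 ≤ 2 / ρ ^ 2 := by
          rw [le_div_iff₀ (by positivity)]
          have : ρ ^ 2 ≤ 1 := pow_le_one₀ hρ.le hρ1
          linarith
        have e : 4 * (48 / ρ) / ρ + 2 / ρ ^ 2 = 194 / ρ ^ 2 := by field_simp; ring
        linarith
      calc (4 * (48 / ρ) / ρ + 2) * (192 * δ ^ 2 * L)
          ≤ 194 / ρ ^ 2 * (192 * δ ^ 2 * L) := by gcongr
        _ = 37248 * (1 / ρ ^ 2 * δ ^ 2 * L) := by ring
        _ ≤ 40000 * (1 / ρ ^ 2 * δ ^ 2 * L) := by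
            have : 0 ≤ 1 / ρ ^ 2 * δ ^ 2 * L := by positivity
            linarith
        _ = _ := by ring
    rw [hS]
    refine le_trans ?_ hfin
    have hvi : ρ ≤ max |(v i).1| |(v i).2| := hHw i hi
    have hsepv : SlopeSep S v δ := by
      intro j hj k hk hjk
      have := hsep j (hSH j hj) k (hSH k hk) hjk
      simpa [v] using this
    rcases le_total |(v i).2| |(v i).1| with hd | hd
    · rw [max_eq_left hd] at hvi
      apply strip_sum hδ hδ1 hρ (by positivity) hsepv (v i) hvi hd
      · intro j hj; exact (norm_fst_le _).trans (hdist j hj)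
      · intro j hj; exact hwedge i hi j (hSH j hj) (Finset.mem_filter.1 hj).2
      · exact h8
      · intro j hj d hd h; exact hIntegr j hj d hd (Or.inl h)
    · rw [max_eq_right hd] at hvi
      apply strip_sum (v := fun j => (v j).swap) hδ hδ1 hρ (by positivity) _ (v i).swap hvi hd
      · intro j hj; exact (norm_snd_le _).trans (hdist j hj)
      · intro j hj
        have := hwedge i hi j (hSH j hj) (Finset.mem_filter.1 hj).2
        rw [abs_sub_comm] at this
        exact this
      · exact h8
      · intro j hj d hd h; exact hIntegr j hj d hd (Or.inr h)
      · intro j hj k hk hjk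
        have := hsepv j hj k hk hjk
        rw [Prod.norm_def] at this ⊢
        rw [max_comm]; exact this
  have hsum : ∑ i ∈ H, ∑ j ∈ H, volume.real (Y i ∩ Y j)
      ≤ H.card * (40000 / ρ ^ 2 * δ ^ 2 * L) := by
    rw [← nsmul_eq_mul]
    exact Finset.sum_le_card_nsmul _ _ _ hrow
  rcases Nat.eq_zero_or_pos H.card with h0 | h0
  · rw [h0]; simp; positivity
  · have hc : (0 : ℝ) < H.card := by exact_mod_cast h0
    have h1 : ((H.card : ℝ) * (lam * δ ^ 2 / 2)) ^ 2
        ≤ volume.real E * (H.card * (40000 / ρ ^ 2 * δ ^ 2 * L)) :=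
      (pow_le_pow_left₀ (by positivity) hlow 2).trans
        (hcs.trans (mul_le_mul_of_nonneg_left hsum measureReal_nonneg))
    have hpos : 0 < (H.card : ℝ) * δ ^ 2 / 4 := by positivity
    refine le_of_mul_le_mul_left ?_ hpos
    calc (H.card : ℝ) * δ ^ 2 / 4 * (H.card * (lam ^ 2 * δ ^ 2))
        = ((H.card : ℝ) * (lam * δ ^ 2 / 2)) ^ 2 := by ring
      _ ≤ _ := h1
      _ = _ := by ring


/-- The discretized estimate at scale `δ`. -/
def KP (ι : Type) (ε c δ : ℝ) : Prop :=
  ∀ (I : Finset ι) (a u : ι → ℝ × ℝ) (E : Set ((ℝ × ℝ) × ℝ)) (lam : ℝ),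
    MeasurableSet E → volume E ≠ ⊤ → 0 < lam → (∀ i ∈ I, ‖u i‖ ≤ 1) → SlopeSep I u δ →
    (∀ i ∈ I, lam * δ ^ 2 ≤ volume.real (MT (a i) (u i) δ ∩ E)) →
    c * δ ^ ε * lam ^ (5 / 2 : ℝ) * δ ^ 2 * (I.card : ℝ) ^ (3 / 4 : ℝ) ≤ volume.real E

lemma overlap {β α : Type*} [MeasurableSpace α] (μ : Measure α) {E : Set α}
    (hE : MeasurableSet E) (hEf : μ E ≠ ⊤) (N : Finset β) {A : β → Set α}
    (hA : ∀ i, MeasurableSet (A i))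
    (hAE : ∀ i, A i ⊆ E) {k : ℝ} (hk : ∀ x ∈ E, cnt N (fun _ => 1) A x ≤ k) :
    ∑ n ∈ N, μ.real (A n) ≤ k * μ.real E := by
  have : Fact (μ E < ⊤) := ⟨hEf.lt_top⟩
  have h : ∫ x in E, cnt N (fun _ => 1) A x ∂μ ≤ ∫ x in E, k ∂μ :=
    setIntegral_mono_on (cnt_integrable _ _ _ hA) (integrable_const _) hE hk
  rw [cnt_integral _ _ _ hA, integral_const] at h
  simp only [one_mul, measureReal_restrict_apply_univ, smul_eq_mul] at h
  have e1 : ∀ i, (μ.restrict E).real (A i) = μ.real (A i) := fun i => by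
    rw [measureReal_restrict_apply (hA i), inter_eq_left.2 (hAE i)]
  simp only [e1] at h
  linarith

lemma rpow_sum_le {β : Type*} (N : Finset β) (m : β → ℝ) (hm : ∀ n, 0 ≤ m n) {p : ℝ}
    (hp : 0 < p) (hp1 : p ≤ 1) : (∑ n ∈ N, m n) ^ p ≤ ∑ n ∈ N, m n ^ p := by
  classical
  induction N using Finset.induction_on with
  | empty => simp [Real.zero_rpow hp.ne']
  | insert a s ha ih =>
    rw [Finset.sum_insert ha, Finset.sum_insert ha]
    have h := NNReal.rpow_add_le_add_rpow ⟨m a, hm a⟩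
      ⟨∑ n ∈ s, m n, Finset.sum_nonneg fun n _ => hm n⟩ hp.le hp1
    have h' : (m a + ∑ n ∈ s, m n) ^ p ≤ m a ^ p + (∑ n ∈ s, m n) ^ p := by
      exact_mod_cast h
    linarith

lemma fiber_rpow {ι β : Type*} [DecidableEq β] (G : Finset ι) (κ : ι → β) :
    (G.card : ℝ) ^ (3 / 4 : ℝ)
      ≤ ∑ k ∈ G.image κ, (((G.filter fun i => κ i = k).card : ℕ) : ℝ) ^ (3 / 4 : ℝ) := by
  have h := Finset.card_eq_sum_card_image κ G
  have h' : (G.card : ℝ) = ∑ k ∈ G.image κ, (((G.filter fun i => κ i = k).card : ℕ) : ℝ) := by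
    exact_mod_cast h
  rw [h']
  exact rpow_sum_le _ (fun k => (((G.filter fun i => κ i = k).card : ℕ) : ℝ))
    (fun _ => Nat.cast_nonneg _) (by norm_num) (by norm_num)

lemma narrowStep {ι : Type} {ε c δ ρ : ℝ} (hρ : 0 < ρ) (hδ : 0 < δ)
    (hK : KP ι ε c (δ / ρ)) (G : Finset ι) (a u : ι → ℝ × ℝ)
    {E : Set ((ℝ × ℝ) × ℝ)} (hE : MeasurableSet E) (hEf : volume E ≠ ⊤) {lam : ℝ} (hlam : 0 < lam)
    (hsep : SlopeSep G u δ) (κ : ι → ℤ × ℤ)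
    (hκ : ∀ i ∈ G, κ i = (⌊(u i).1 / ρ⌋, ⌊(u i).2 / ρ⌋))
    (A : ℤ × ℤ → Set ((ℝ × ℝ) × ℝ)) (hA : ∀ k, MeasurableSet (A k)) (hAE : ∀ k, A k ⊆ E)
    (hov : ∀ N : Finset (ℤ × ℤ), ∀ x ∈ E, cnt N (fun _ => 1) A x ≤ 18)
    (hG : ∀ i ∈ G, lam * δ ^ 2 ≤ volume.real (MT (a i) (u i) δ ∩ A (κ i))) :
    c * (δ / ρ) ^ ε * lam ^ (5 / 2 : ℝ) * δ ^ 2 * (G.card : ℝ) ^ (3 / 4 : ℝ)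
      ≤ 18 * volume.real E := by
  classical
  rcases le_or_gt c 0 with hc | hc
  · have h1 : 0 ≤ 18 * volume.real E := by positivity
    refine le_trans ?_ h1
    have : 0 ≤ (δ / ρ) ^ ε * lam ^ (5 / 2 : ℝ) * δ ^ 2 * (G.card : ℝ) ^ (3 / 4 : ℝ) := by
      positivity
    nlinarith
  have key : ∀ k ∈ G.image κ,
      c * (δ / ρ) ^ ε * lam ^ (5 / 2 : ℝ) * δ ^ 2 *
        (((G.filter fun i => κ i = k).card : ℕ) : ℝ) ^ (3 / 4 : ℝ) ≤ volume.real (A k) := by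
    intro k _
    set u₀ : ℝ × ℝ := (k.1 * ρ, k.2 * ρ) with hu₀
    let Ψ : (ℝ × ℝ) × ℝ → (ℝ × ℝ) × ℝ := fun p => (ρ • p.1 + p.2 • u₀, p.2)
    have hΨ : Measurable Ψ := by fun_prop
    have hvol : ∀ B, MeasurableSet B → volume.real (Ψ ⁻¹' B) = (ρ ^ 2)⁻¹ * volume.real B := by
      intro B hB
      rw [measureReal_def, vol_narrow hB hρ, ENNReal.toReal_mul,
        ENNReal.toReal_ofReal (by positivity), measureReal_def]
    have hAf : volume (A k) ≠ ⊤ := ne_top_of_le_ne_top hEf (measure_mono (hAE k))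
    have h := hK (G.filter fun i => κ i = k) (fun i => ρ⁻¹ • a i)
      (fun i => ρ⁻¹ • (u i - u₀)) (Ψ ⁻¹' A k) lam (hΨ (hA k))
      (by
        rw [vol_narrow (hA k) hρ]
        exact ENNReal.mul_ne_top ENNReal.ofReal_ne_top hAf) hlam
      (by
        intro i hi
        rw [Finset.mem_filter] at hi
        have h1 := hκ i hi.1
        rw [hi.2] at h1
        have h2 : ∀ (x : ℝ) (l : ℤ), l = ⌊x / ρ⌋ → |ρ⁻¹ * (x - l * ρ)| ≤ 1 := by
          intro x l hl
          have e : ρ⁻¹ * (x - l * ρ) = x / ρ - l := by field_simp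
          rw [e, hl, abs_le]
          have := Int.floor_le (x / ρ)
          have := Int.lt_floor_add_one (x / ρ)
          constructor <;> linarith
        rw [Prod.norm_def]
        apply max_le
        · simpa [u₀] using h2 (u i).1 k.1 (by rw [h1])
        · simpa [u₀] using h2 (u i).2 k.2 (by rw [h1]))
      (by
        intro i hi j hj hij
        have := hsep i (Finset.mem_filter.1 hi).1 j (Finset.mem_filter.1 hj).1 hij
        rw [← smul_sub, sub_sub_sub_cancel_right, norm_smul, norm_inv,
          Real.norm_of_nonneg hρ.le, div_eq_inv_mul]
        gcongr)
      (by
        intro i hi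
        rw [Finset.mem_filter] at hi
        have h1 := hG i hi.1
        rw [hi.2] at h1
        have e : MT (ρ⁻¹ • a i) (ρ⁻¹ • (u i - u₀)) (δ / ρ) ∩ Ψ ⁻¹' A k
          = Ψ ⁻¹' (MT (a i) (u i) δ ∩ A k) := by
          rw [preimage_inter, ← MT_narrow (a i) (u i) u₀ hρ]
        rw [e, hvol _ ((MT_meas _ _ _).inter (hA k))]
        have e2 : lam * (δ / ρ) ^ 2 = (ρ ^ 2)⁻¹ * (lam * δ ^ 2) := by field_simp
        rw [e2]; gcongr)
    rw [hvol _ (hA k)] at h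
    have h3 : (ρ ^ 2)⁻¹ * (c * (δ / ρ) ^ ε * lam ^ (5 / 2 : ℝ) * δ ^ 2 *
        (((G.filter fun i => κ i = k).card : ℕ) : ℝ) ^ (3 / 4 : ℝ))
        ≤ (ρ ^ 2)⁻¹ * volume.real (A k) := by
      refine le_trans (le_of_eq ?_) h
      rw [div_pow]; ring
    exact le_of_mul_le_mul_left h3 (by positivity)
  calc c * (δ / ρ) ^ ε * lam ^ (5 / 2 : ℝ) * δ ^ 2 * (G.card : ℝ) ^ (3 / 4 : ℝ)
      ≤ c * (δ / ρ) ^ ε * lam ^ (5 / 2 : ℝ) * δ ^ 2 *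
        ∑ k ∈ G.image κ, (((G.filter fun i => κ i = k).card : ℕ) : ℝ) ^ (3 / 4 : ℝ) := by
        have := fiber_rpow G κ
        gcongr
    _ = ∑ k ∈ G.image κ, c * (δ / ρ) ^ ε * lam ^ (5 / 2 : ℝ) * δ ^ 2 *
        (((G.filter fun i => κ i = k).card : ℕ) : ℝ) ^ (3 / 4 : ℝ) := by rw [Finset.mul_sum]
    _ ≤ ∑ k ∈ G.image κ, volume.real (A k) := Finset.sum_le_sum key
    _ ≤ 18 * volume.real E := overlap volume hE hEf _ hA hAE (hov _)

lemma thin_out {ι : Type} (G : Finset ι) (u : ι → ℝ × ℝ) {δ ρ : ℝ} (hδ : 0 < δ) (hρ : 0 < ρ)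
    (hρ1 : ρ ≤ 1) (hsep : SlopeSep G u δ) :
    ∃ S ⊆ G, SlopeSep S u (δ / ρ) ∧ ρ ^ 2 / 16 * (G.card : ℝ) ≤ S.card := by
  classical
  obtain ⟨S, h1, h2, h3⟩ := exists_max_sep (↑G : Set ι) u (div_pos hδ hρ) G.card
    (fun S hS _ => Finset.card_le_card (Finset.coe_subset.1 hS))
  refine ⟨S, Finset.coe_subset.1 h1, h2, ?_⟩
  choose! f hf using h3
  have hfib := Finset.card_eq_sum_card_fiberwise (f := f) (s := G) (t := S)
    (fun i hi => (hf i hi).1)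
  have hb : ∀ j ∈ S, (((G.filter fun i => f i = j).card : ℕ) : ℝ) ≤ 16 / ρ ^ 2 := by
    intro j _
    have := sep_count (S := G.filter fun i => f i = j) hδ (hsep.mono (Finset.filter_subset _ _))
      (u j) (R := δ / ρ) (by positivity) (by
        intro i hi
        rw [Finset.mem_filter] at hi
        have := (hf i hi.1).2
        rw [hi.2] at this
        exact this.le)
    refine this.trans ?_
    have e1 : 2 * (δ / ρ) / δ + 2 = 2 / ρ + 2 := by field_simp
    have e2 : 2 ≤ 2 / ρ := by rw [le_div_iff₀ hρ]; linarith
    have e3 : 16 / ρ ^ 2 = (2 / ρ + 2 / ρ) ^ 2 := by field_simp; norm_num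
    rw [e1, e3]
    gcongr
  have h4 : (G.card : ℝ) ≤ S.card * (16 / ρ ^ 2) := by
    rw [hfib]
    push_cast
    rw [← nsmul_eq_mul]
    exact Finset.sum_le_card_nsmul _ _ _ hb
  calc ρ ^ 2 / 16 * (G.card : ℝ) ≤ ρ ^ 2 / 16 * ((S.card : ℝ) * (16 / ρ ^ 2)) := by gcongr
    _ = (S.card : ℝ) := by field_simp

lemma slab_overlap {ρ : ℝ} (hρ : 0 < ρ) (E : Set ((ℝ × ℝ) × ℝ)) (N : Finset ℤ)
    (x : (ℝ × ℝ) × ℝ) :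
    cnt N (fun _ => 1) (fun n : ℤ => E ∩ {p | |p.2 - n * ρ| ≤ ρ}) x ≤ 3 := by
  classical
  unfold cnt
  have h : ∀ n ∈ N, (1 : ℝ) * (E ∩ {p : (ℝ × ℝ) × ℝ | |p.2 - n * ρ| ≤ ρ}).indicator
      (fun _ => (1 : ℝ)) x ≤ if n ∈ Finset.Icc ⌈x.2 / ρ - 1⌉ ⌊x.2 / ρ + 1⌋ then 1 else 0 := by
    intro n _
    rw [one_mul]
    by_cases hx : x ∈ E ∩ {p : (ℝ × ℝ) × ℝ | |p.2 - n * ρ| ≤ ρ}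
    · rw [indicator_of_mem hx, if_pos]
      have h2 : |x.2 - n * ρ| ≤ ρ := hx.2
      rw [abs_le] at h2
      rw [Finset.mem_Icc, Int.ceil_le, Int.le_floor]
      constructor
      · rw [sub_le_iff_le_add, div_le_iff₀ hρ]; linarith
      · rw [← sub_le_iff_le_add, le_div_iff₀ hρ]; linarith
    · rw [indicator_of_notMem hx]; split_ifs <;> norm_num
  refine (Finset.sum_le_sum h).trans ?_
  rw [Finset.sum_ite_mem, Finset.sum_const, nsmul_eq_mul, mul_one]
  have h3 : (N ∩ Finset.Icc ⌈x.2 / ρ - 1⌉ ⌊x.2 / ρ + 1⌋).card ≤ 3 := by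
    refine (Finset.card_le_card Finset.inter_subset_right).trans ?_
    rw [Int.card_Icc]
    have h4 : ⌊x.2 / ρ + 1⌋ - ⌈x.2 / ρ - 1⌉ ≤ 2 := by
      have h5 := Int.floor_le (x.2 / ρ + 1)
      have h6 := Int.le_ceil (x.2 / ρ - 1)
      have : ((⌊x.2 / ρ + 1⌋ - ⌈x.2 / ρ - 1⌉ : ℤ) : ℝ) ≤ 2 := by push_cast; linarith
      exact_mod_cast this
    omega
  exact_mod_cast h3

lemma rpow_conc {lam ρ m m' : ℝ} (hlam : 0 < lam) (hρ : 0 < ρ) (hm : 0 ≤ m)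
    (h : ρ ^ 2 / 16 * m ≤ m') :
    lam ^ (5 / 2 : ℝ) * m ^ (3 / 4 : ℝ) ≤
      48 * ρ * ((lam / (2 * ρ)) ^ (5 / 2 : ℝ) * m' ^ (3 / 4 : ℝ)) := by
  have h1 : (ρ ^ 2 / 16 * m) ^ (3 / 4 : ℝ) ≤ m' ^ (3 / 4 : ℝ) :=
    Real.rpow_le_rpow (by positivity) h (by norm_num)
  have h16 : (16 : ℝ) ^ (3 / 4 : ℝ) = 8 := by
    rw [show (16 : ℝ) = 2 ^ (4 : ℝ) by norm_num, ← Real.rpow_mul (by norm_num)]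
    norm_num
  have h2 : (ρ ^ 2 / 16 * m) ^ (3 / 4 : ℝ) = ρ ^ (3 / 2 : ℝ) / 8 * m ^ (3 / 4 : ℝ) := by
    rw [Real.mul_rpow (by positivity) hm, Real.div_rpow (by positivity) (by norm_num), h16,
      ← Real.rpow_natCast, ← Real.rpow_mul hρ.le]
    norm_num
  have h25 : (2 : ℝ) ^ (5 / 2 : ℝ) ≤ 6 := by
    have : (2 : ℝ) ^ (5 / 2 : ℝ) = ((2 : ℝ) ^ (5 : ℝ)) ^ (1 / 2 : ℝ) := by
      rw [← Real.rpow_mul (by norm_num)]; norm_num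
    rw [this, ← Real.sqrt_eq_rpow, Real.sqrt_le_left (by norm_num)]
    norm_num
  have h3 : (lam / (2 * ρ)) ^ (5 / 2 : ℝ)
      = lam ^ (5 / 2 : ℝ) / ((2 : ℝ) ^ (5 / 2 : ℝ) * (ρ * ρ ^ (3 / 2 : ℝ))) := by
    rw [Real.div_rpow hlam.le (by positivity), Real.mul_rpow (by norm_num) hρ.le]
    congr 2
    nth_rewrite 2 [← Real.rpow_one ρ]
    rw [← Real.rpow_add hρ]; norm_num
  have hp : 0 < ρ ^ (3 / 2 : ℝ) := by positivity
  have h4 : lam ^ (5 / 2 : ℝ) / (6 * (ρ * ρ ^ (3 / 2 : ℝ))) ≤ (lam / (2 * ρ)) ^ (5 / 2 : ℝ) := by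
    rw [h3]; gcongr
  calc lam ^ (5 / 2 : ℝ) * m ^ (3 / 4 : ℝ)
      = 48 * ρ * (lam ^ (5 / 2 : ℝ) / (6 * (ρ * ρ ^ (3 / 2 : ℝ)))
          * (ρ ^ (3 / 2 : ℝ) / 8 * m ^ (3 / 4 : ℝ))) := by field_simp; ring
    _ ≤ _ := by
      rw [← h2]
      gcongr

lemma concStep {ι : Type} {ε c δ ρ : ℝ} (hρ : 0 < ρ) (hρ1 : ρ ≤ 1) (hδ : 0 < δ) (hc : 0 < c)
    (hK : KP ι ε c (δ / ρ)) (G : Finset ι) (a u : ι → ℝ × ℝ)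
    {E : Set ((ℝ × ℝ) × ℝ)} (hE : MeasurableSet E) (hEf : volume E ≠ ⊤) {lam : ℝ} (hlam : 0 < lam)
    (hu : ∀ i ∈ G, ‖u i‖ ≤ 1) (hsep : SlopeSep G u δ) (κ : ι → ℤ)
    (hG : ∀ i ∈ G, lam * δ ^ 2 / 2
      ≤ volume.real (MT (a i) (u i) δ ∩ (E ∩ {p | |p.2 - κ i * ρ| ≤ ρ}))) :
    c * (δ / ρ) ^ ε * lam ^ (5 / 2 : ℝ) * δ ^ 2 * (G.card : ℝ) ^ (3 / 4 : ℝ)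
      ≤ 144 * volume.real E := by
  classical
  let A : ℤ → Set ((ℝ × ℝ) × ℝ) := fun n => E ∩ {p | |p.2 - n * ρ| ≤ ρ}
  have hA : ∀ n, MeasurableSet (A n) := fun n =>
    hE.inter (measurableSet_le (by fun_prop) measurable_const)
  have hAE : ∀ n, A n ⊆ E := fun n => inter_subset_left
  have key : ∀ k ∈ G.image κ,
      c * (δ / ρ) ^ ε * lam ^ (5 / 2 : ℝ) * δ ^ 2 *
        (((G.filter fun i => κ i = k).card : ℕ) : ℝ) ^ (3 / 4 : ℝ) ≤ 48 * volume.real (A k) := by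
    intro k _
    obtain ⟨S, hSG, hSsep, hScard⟩ := thin_out (G.filter fun i => κ i = k) u hδ hρ hρ1
      (hsep.mono (Finset.filter_subset _ _))
    have hAf : volume (A k) ≠ ⊤ := ne_top_of_le_ne_top hEf (measure_mono (hAE k))
    let Ψ : (ℝ × ℝ) × ℝ → (ℝ × ℝ) × ℝ := fun p => (ρ • p.1, ρ * p.2 + k * ρ)
    have hΨ : Measurable Ψ := by fun_prop
    have hvol : ∀ B, volume.real (Ψ ⁻¹' B) = (ρ ^ 3)⁻¹ * volume.real B := by
      intro B
      rw [measureReal_def, vol_conc hρ, ENNReal.toReal_mul,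
        ENNReal.toReal_ofReal (by positivity), measureReal_def]
    have hPf : volume (Ψ ⁻¹' A k) ≠ ⊤ := by
      rw [vol_conc hρ]
      exact ENNReal.mul_ne_top ENNReal.ofReal_ne_top hAf
    have h := hK S (fun i => ρ⁻¹ • (a i + (k * ρ) • u i)) u (Ψ ⁻¹' A k) (lam / (2 * ρ))
      (hΨ (hA k)) hPf (by positivity)
      (fun i hi => hu i (Finset.mem_filter.1 (hSG hi)).1) hSsep
      (by
        intro i hi
        have hi' := Finset.mem_filter.1 (hSG hi)
        have h1 := hG i hi'.1
        rw [hi'.2] at h1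
        have hsub : Ψ ⁻¹' (MT (a i) (u i) δ ∩ A k)
            ⊆ MT (ρ⁻¹ • (a i + (k * ρ) • u i)) (u i) (δ / ρ) ∩ Ψ ⁻¹' A k := by
          intro p hp
          refine ⟨MT_conc (a i) (u i) hρ (k * ρ) ⟨hp.1, hp.2.2⟩, hp.2⟩
        have h2 := measureReal_mono hsub
          (ne_top_of_le_ne_top hPf (measure_mono inter_subset_right))
        rw [hvol] at h2
        refine le_trans ?_ h2
        have e2 : lam / (2 * ρ) * (δ / ρ) ^ 2 = (ρ ^ 3)⁻¹ * (lam * δ ^ 2 / 2) := by field_simp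
        rw [e2]; gcongr)
    rw [hvol] at h
    have h5 := rpow_conc (m' := S.card) hlam hρ (Nat.cast_nonneg _) hScard
    calc c * (δ / ρ) ^ ε * lam ^ (5 / 2 : ℝ) * δ ^ 2 *
        (((G.filter fun i => κ i = k).card : ℕ) : ℝ) ^ (3 / 4 : ℝ)
        = c * (δ / ρ) ^ ε * δ ^ 2 * (lam ^ (5 / 2 : ℝ) *
        (((G.filter fun i => κ i = k).card : ℕ) : ℝ) ^ (3 / 4 : ℝ)) := by ring
      _ ≤ c * (δ / ρ) ^ ε * δ ^ 2 * (48 * ρ * ((lam / (2 * ρ)) ^ (5 / 2 : ℝ)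
            * (S.card : ℝ) ^ (3 / 4 : ℝ))) := by gcongr
      _ = 48 * ρ ^ 3 * (c * (δ / ρ) ^ ε * (lam / (2 * ρ)) ^ (5 / 2 : ℝ) * (δ / ρ) ^ 2
            * (S.card : ℝ) ^ (3 / 4 : ℝ)) := by
          have e : (δ / ρ) ^ 2 = δ ^ 2 / ρ ^ 2 := div_pow _ _ _
          rw [e]; field_simp
      _ ≤ 48 * ρ ^ 3 * ((ρ ^ 3)⁻¹ * volume.real (A k)) := by gcongr
      _ = _ := by field_simp
  calc c * (δ / ρ) ^ ε * lam ^ (5 / 2 : ℝ) * δ ^ 2 * (G.card : ℝ) ^ (3 / 4 : ℝ)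
      ≤ c * (δ / ρ) ^ ε * lam ^ (5 / 2 : ℝ) * δ ^ 2 *
        ∑ k ∈ G.image κ, (((G.filter fun i => κ i = k).card : ℕ) : ℝ) ^ (3 / 4 : ℝ) := by
        have := fiber_rpow G κ
        gcongr
    _ = ∑ k ∈ G.image κ, c * (δ / ρ) ^ ε * lam ^ (5 / 2 : ℝ) * δ ^ 2 *
        (((G.filter fun i => κ i = k).card : ℕ) : ℝ) ^ (3 / 4 : ℝ) := by rw [Finset.mul_sum]
    _ ≤ ∑ k ∈ G.image κ, 48 * volume.real (A k) := Finset.sum_le_sum key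
    _ = 48 * ∑ k ∈ G.image κ, volume.real (A k) := by rw [Finset.mul_sum]
    _ ≤ 48 * (3 * volume.real E) := by
        have := overlap volume hE hEf (G.image κ) hA hAE (k := 3)
          (fun x _ => slab_overlap hρ E _ x)
        gcongr
    _ = _ := by ring


/-- cell index of a slope -/
def cell (ρ : ℝ) (x : ℝ × ℝ) : ℤ × ℤ := (⌊x.1 / ρ⌋, ⌊x.2 / ρ⌋)

/-- the nine cells adjacent to a cell -/
def adj (k : ℤ × ℤ) : Finset (ℤ × ℤ) :=
  Finset.Icc (k.1 - 1) (k.1 + 1) ×ˢ Finset.Icc (k.2 - 1) (k.2 + 1)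

lemma adj_card (k : ℤ × ℤ) : (adj k).card = 9 := by
  unfold adj
  rw [Finset.card_product, Int.card_Icc, Int.card_Icc]
  have h1 : (k.1 + 1 + 1 - (k.1 - 1)).toNat = 3 := by omega
  have h2 : (k.2 + 1 + 1 - (k.2 - 1)).toNat = 3 := by omega
  rw [h1, h2]

lemma floor_adj {x y ρ : ℝ} (hρ : 0 < ρ) (h : |x - y| < ρ) :
    ⌊y / ρ⌋ ∈ Finset.Icc (⌊x / ρ⌋ - 1) (⌊x / ρ⌋ + 1) := by
  have h1 : |x / ρ - y / ρ| < 1 := by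
    rw [← sub_div, abs_div, abs_of_pos hρ, div_lt_one hρ]; exact h
  rw [abs_lt] at h1
  rw [Finset.mem_Icc]
  constructor
  · rw [Int.le_floor]; push_cast
    have := Int.floor_le (x / ρ); linarith
  · rw [← Int.lt_add_one_iff, Int.floor_lt]; push_cast
    have := Int.lt_floor_add_one (x / ρ); linarith

lemma cell_adj {x y : ℝ × ℝ} {ρ : ℝ} (hρ : 0 < ρ) (h : ‖x - y‖ < ρ) :
    cell ρ y ∈ adj (cell ρ x) := by
  have h1 := (norm_fst_le _).trans_lt h
  have h2 := (norm_snd_le _).trans_lt h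
  unfold adj cell
  rw [Finset.mem_product]
  exact ⟨floor_adj hρ h1, floor_adj hρ h2⟩

section pointwise
variable {ι α : Type*}

lemma ind_nn (T : Set α) (x : α) : 0 ≤ T.indicator (fun _ => (1 : ℝ)) x :=
  indicator_nonneg (fun _ _ => zero_le_one) _

lemma cnt_fibers_le (I : Finset ι) {w : ι → ℝ} (hw : ∀ i, 0 ≤ w i) (T : ι → Set α)
    (κ : ι → ℤ × ℤ) (N : Finset (ℤ × ℤ)) (x : α) :
    ∑ k ∈ N, cnt (I.filter fun i => κ i = k) w T x ≤ cnt I w T x := by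
  classical
  unfold cnt
  rw [Finset.sum_comm' (t' := I.filter fun i => κ i ∈ N) (s' := fun i => {κ i})
    (by intro k i; simp only [Finset.mem_filter, Finset.mem_singleton]; aesop)]
  simp only [Finset.sum_singleton]
  apply Finset.sum_le_sum_of_subset_of_nonneg (Finset.filter_subset _ _)
  intro i _ _
  exact mul_nonneg (hw i) (ind_nn _ _)

lemma pointwise_bn (I : Finset ι) {w : ι → ℝ} (hw : ∀ i, 0 ≤ w i) (T : ι → Set α)
    (u : ι → ℝ × ℝ) {ρ : ℝ} (hρ : 0 < ρ) (x : α)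
    (hk : ∀ k, cnt (I.filter fun i => cell ρ (u i) = k) w T x ≤ cnt I w T x / 18) :
    cnt I w T x ^ 2 ≤ 2 * cnt ((I ×ˢ I).filter fun q => ρ ≤ ‖u q.1 - u q.2‖)
      (fun q => w q.1 * w q.2) (fun q => T q.1 ∩ T q.2) x := by
  classical
  set f := cnt I w T x with hf
  have hf0 : 0 ≤ f := cnt_nonneg I hw T x
  have hsplit := cnt_sq I w T x
  unfold cnt at hsplit
  rw [← Finset.sum_filter_add_sum_filter_not (I ×ˢ I) (fun q => ρ ≤ ‖u q.1 - u q.2‖)] at hsplit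
  have hnear : ∑ q ∈ (I ×ˢ I).filter (fun q => ¬ ρ ≤ ‖u q.1 - u q.2‖),
      w q.1 * w q.2 * (T q.1 ∩ T q.2).indicator (fun _ => (1 : ℝ)) x ≤ f ^ 2 / 2 := by
    rw [Finset.sum_filter, Finset.sum_product]
    have hrow : ∀ i ∈ I, (∑ j ∈ I, if ¬ ρ ≤ ‖u i - u j‖ then
        w i * w j * (T i ∩ T j).indicator (fun _ => (1 : ℝ)) x else 0)
        ≤ w i * (T i).indicator (fun _ => (1 : ℝ)) x * (f / 2) := by
      intro i _
      have h1 : (∑ j ∈ I, if ¬ ρ ≤ ‖u i - u j‖ then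
        w i * w j * (T i ∩ T j).indicator (fun _ => (1 : ℝ)) x else 0)
        = w i * (T i).indicator (fun _ => (1 : ℝ)) x *
          ∑ j ∈ I.filter (fun j => ¬ ρ ≤ ‖u i - u j‖), w j * (T j).indicator (fun _ => (1 : ℝ)) x := by
        rw [← Finset.sum_filter, Finset.mul_sum]
        apply Finset.sum_congr rfl
        intro j _
        rw [← ind_mul]; ring
      rw [h1]
      apply mul_le_mul_of_nonneg_left _ (mul_nonneg (hw i) (ind_nn _ _))
      calc ∑ j ∈ I.filter (fun j => ¬ ρ ≤ ‖u i - u j‖), w j * (T j).indicator (fun _ => (1 : ℝ)) x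
          ≤ ∑ j ∈ I.filter (fun j => cell ρ (u j) ∈ adj (cell ρ (u i))),
              w j * (T j).indicator (fun _ => (1 : ℝ)) x := by
            apply Finset.sum_le_sum_of_subset_of_nonneg
            · intro j hj
              rw [Finset.mem_filter] at hj ⊢
              exact ⟨hj.1, cell_adj hρ (not_le.1 hj.2)⟩
            · intro j _ _; exact mul_nonneg (hw j) (ind_nn _ _)
        _ = ∑ k ∈ adj (cell ρ (u i)), cnt (I.filter fun i => cell ρ (u i) = k) w T x := by
            unfold cnt
            rw [Finset.sum_comm' (s := adj (cell ρ (u i)))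
              (t' := I.filter fun j => cell ρ (u j) ∈ adj (cell ρ (u i)))
              (s' := fun i => {cell ρ (u i)})
              (by intro k i; simp only [Finset.mem_filter, Finset.mem_singleton]; aesop)]
            simp only [Finset.sum_singleton]
        _ ≤ ∑ k ∈ adj (cell ρ (u i)), f / 18 := Finset.sum_le_sum fun k _ => hk k
        _ = f / 2 := by
            rw [Finset.sum_const, adj_card, nsmul_eq_mul]; push_cast; ring
    refine (Finset.sum_le_sum hrow).trans ?_
    rw [← Finset.sum_mul]
    have : ∑ i ∈ I, w i * (T i).indicator (fun _ => (1 : ℝ)) x = f := rfl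
    rw [this]
    exact le_of_eq (by ring)
  change f ^ 2 ≤ _
  unfold cnt
  change f ^ 2 = _ at hsplit
  linarith

end pointwise

lemma broadNarrow {ι : Type} {ε c δ ρ lam : ℝ} (hρ : 0 < ρ) (hρ1 : ρ ≤ 1) (hδ : 0 < δ)
    (hδ1 : δ ≤ 1) (hlam : 0 < lam) (hc : 0 < c)
    (hK : KP ι ε c (δ / ρ)) (I : Finset ι) (a u : ι → ℝ × ℝ)
    {E : Set ((ℝ × ℝ) × ℝ)} (hE : MeasurableSet E) (hEf : volume E ≠ ⊤)
    (hu : ∀ i ∈ I, ‖u i‖ ≤ 1) (hsep : SlopeSep I u δ)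
    (hI : ∀ i ∈ I, lam * δ ^ 2 ≤ volume.real (MT (a i) (u i) δ ∩ E))
    (hnc : ∀ i ∈ I, ∀ t₀ : ℝ,
      lam * δ ^ 2 / 2 ≤ volume.real (MT (a i) (u i) δ ∩ E ∩ {p | ρ / 2 < |p.2 - t₀|})) :
    c * (δ / ρ) ^ ε * (lam / 72) ^ (5 / 2 : ℝ) * δ ^ 2 * ((I.card : ℝ) / 72) ^ (3 / 4 : ℝ)
      ≤ 18 * volume.real E ∨
    (I.card : ℝ) * (lam ^ 4 * δ ^ 3)
      ≤ 20480000 / ρ ^ 3 * (1 + Real.log (10 / δ)) * volume.real E ^ 2 := by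
  classical
  have hFact : Fact (volume E < ⊤) := ⟨hEf.lt_top⟩
  set L := 1 + Real.log (10 / δ) with hL
  have hL0 : 0 ≤ L := by
    have : 0 ≤ Real.log (10 / δ) := Real.log_nonneg (by rw [le_div_iff₀ hδ]; linarith)
    linarith
  let T : ι → Set ((ℝ × ℝ) × ℝ) := fun i => MT (a i) (u i) δ
  have hT : ∀ i, MeasurableSet (T i) := fun i => MT_meas _ _ _
  let w : ι → ℝ := fun i => if i ∈ I then lam * δ ^ 2 / volume.real (T i ∩ E) else 0
  have hs : ∀ i ∈ I, 0 < volume.real (T i ∩ E) := fun i hi =>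
    lt_of_lt_of_le (by positivity) (hI i hi)
  have hw0 : ∀ i, 0 ≤ w i := by
    intro i; simp only [w]; split_ifs
    · positivity
    · exact le_rfl
  have hw1 : ∀ i, w i ≤ 1 := by
    intro i; simp only [w]; split_ifs with h
    · rw [div_le_one (hs i h)]; exact hI i h
    · exact zero_le_one
  have hws : ∀ i ∈ I, w i * volume.real (T i ∩ E) = lam * δ ^ 2 := by
    intro i hi
    simp only [w, if_pos hi]
    rw [div_mul_cancel₀ _ (hs i hi).ne']
  let f := cnt I w T
  let fk : ℤ × ℤ → (ℝ × ℝ) × ℝ → ℝ := fun k => cnt (I.filter fun i => cell ρ (u i) = k) w T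
  let J := (I ×ˢ I).filter fun q => ρ ≤ ‖u q.1 - u q.2‖
  let B := cnt J (fun q => w q.1 * w q.2) (fun q => T q.1 ∩ T q.2)
  have hTT : ∀ q : ι × ι, MeasurableSet (T q.1 ∩ T q.2) := fun q => (hT _).inter (hT _)
  have hf0 : ∀ x, 0 ≤ f x := cnt_nonneg I hw0 T
  have hfm : Measurable f := cnt_measurable _ _ hT
  have hBm : Measurable B := cnt_measurable _ _ hTT
  have hB0 : ∀ x, 0 ≤ B x := cnt_nonneg _ (fun q => mul_nonneg (hw0 _) (hw0 _)) _
  let A : ℤ × ℤ → Set ((ℝ × ℝ) × ℝ) := fun k => E ∩ {x | 0 < f x ∧ f x ≤ 18 * fk k x}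
  have hA : ∀ k, MeasurableSet (A k) := fun k => by
    have h1 : MeasurableSet {x | 0 < f x} := measurableSet_lt measurable_const hfm
    have h2 : MeasurableSet {x | f x ≤ 18 * fk k x} :=
      measurableSet_le hfm ((cnt_measurable _ _ hT).const_mul _)
    exact hE.inter (h1.inter h2)
  have hAE : ∀ k, A k ⊆ E := fun k => inter_subset_left
  have hov : ∀ N : Finset (ℤ × ℤ), ∀ x ∈ E, cnt N (fun _ => 1) A x ≤ 18 := by
    intro N x _
    rcases (hf0 x).eq_or_lt with h0 | h0
    · have : cnt N (fun _ => 1) A x = 0 := by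
        unfold cnt
        apply Finset.sum_eq_zero
        intro k _
        rw [indicator_of_notMem, mul_zero]
        intro hx
        have := hx.2.1
        linarith
      rw [this]; norm_num
    · have h1 : cnt N (fun _ => 1) A x ≤ ∑ k ∈ N, 18 / f x * fk k x := by
        unfold cnt
        apply Finset.sum_le_sum
        intro k _
        rw [one_mul]
        have hfk : 0 ≤ fk k x := cnt_nonneg _ hw0 T x
        by_cases hx : x ∈ A k
        · rw [indicator_of_mem hx, div_mul_eq_mul_div, le_div_iff₀ h0, one_mul]
          exact hx.2.2
        · rw [indicator_of_notMem hx]; positivity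
      refine h1.trans ?_
      rw [← Finset.mul_sum]
      have h2 : ∑ k ∈ N, fk k x ≤ f x := cnt_fibers_le I hw0 T (fun i => cell ρ (u i)) N x
      calc 18 / f x * ∑ k ∈ N, fk k x ≤ 18 / f x * f x := by gcongr
        _ = 18 := by field_simp
  let Eb : Set ((ℝ × ℝ) × ℝ) := {x | f x ^ 2 ≤ 2 * B x}
  have hEb : MeasurableSet Eb := measurableSet_le (hfm.pow_const 2) (hBm.const_mul _)
  let TA : ι → Set ((ℝ × ℝ) × ℝ) := fun i => T i ∩ A (cell ρ (u i))
  have hTA : ∀ i, MeasurableSet (TA i) := fun i => (hT i).inter (hA _)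
  let h := cnt I w TA
  have hh0 : ∀ x, 0 ≤ h x := cnt_nonneg I hw0 TA
  have hpt : ∀ x ∈ E, f x ≤ Eb.indicator f x + 18 * h x := by
    intro x hx
    by_cases hxb : x ∈ Eb
    · rw [indicator_of_mem hxb]; linarith [hh0 x]
    · rw [indicator_of_notMem hxb, zero_add]
      have hex : ∃ k, f x / 18 < fk k x := by
        by_contra hcon
        push Not at hcon
        exact hxb (pointwise_bn I hw0 T u hρ x hcon)
      obtain ⟨k, hk⟩ := hex
      have hfk : fk k x ≤ h x := by
        simp only [fk, h, cnt]
        rcases (hf0 x).eq_or_lt with h0 | h0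
        · exfalso
          apply hxb
          show f x ^ 2 ≤ 2 * B x
          rw [← h0]; have := hB0 x; simp; linarith
        · have hxA : x ∈ A k := ⟨hx, h0, by linarith⟩
          refine le_trans (le_of_eq ?_) (Finset.sum_le_sum_of_subset_of_nonneg
            (Finset.filter_subset (fun i => cell ρ (u i) = k) I)
            (fun i _ _ => mul_nonneg (hw0 i) (ind_nn _ _)))
          apply Finset.sum_congr rfl
          intro i hi
          rw [Finset.mem_filter] at hi
          congr 1
          simp only [TA, hi.2]
          by_cases hxT : x ∈ T i
          · rw [indicator_of_mem hxT, indicator_of_mem (show x ∈ T i ∩ A k from ⟨hxT, hxA⟩)]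
          · rw [indicator_of_notMem hxT, indicator_of_notMem (fun h => hxT h.1)]
      linarith
  have hfint : Integrable f (volume.restrict E) := cnt_integrable _ _ _ hT
  have hHIntegr : Integrable h (volume.restrict E) := cnt_integrable _ _ _ hTA
  have hgint : Integrable (Eb.indicator f) (volume.restrict E) := hfint.indicator hEb
  have hIntegr : (I.card : ℝ) * (lam * δ ^ 2)
      ≤ (∫ x in E, Eb.indicator f x) + 18 * ∑ i ∈ I, w i * volume.real (TA i) := by
    have h1 : ∫ x in E, f x ≤ ∫ x in E, (Eb.indicator f x + 18 * h x) :=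
      setIntegral_mono_on hfint (hgint.add (hHIntegr.const_mul _)) hE hpt
    rw [integral_add hgint (hHIntegr.const_mul _), integral_const_mul] at h1
    simp only [f, h] at h1
    rw [cnt_integral _ _ _ hT, cnt_integral _ _ _ hTA] at h1
    have e1 : ∑ i ∈ I, w i * (volume.restrict E).real (T i) = (I.card : ℝ) * (lam * δ ^ 2) := by
      rw [← nsmul_eq_mul, ← Finset.sum_const]
      apply Finset.sum_congr rfl
      intro i hi
      rw [measureReal_restrict_apply (hT i), hws i hi]
    have e2 : ∀ i, (volume.restrict E).real (TA i) = volume.real (TA i) := fun i => by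
      rw [measureReal_restrict_apply (hTA i),
        inter_eq_left.2 (inter_subset_right.trans (hAE _))]
    simp only [e2] at h1
    rw [e1] at h1
    exact h1
  rcases le_or_gt ((I.card : ℝ) * (lam * δ ^ 2) / 36) (∑ i ∈ I, w i * volume.real (TA i))
    with hcase | hcase
  · left
    let G := I.filter fun i => lam / 72 * δ ^ 2 ≤ volume.real (TA i)
    have hGI : G ⊆ I := Finset.filter_subset _ _
    have hGc : (I.card : ℝ) / 72 ≤ G.card := by
      have h1 : ∀ i ∈ I, w i * volume.real (TA i)
          ≤ (if lam / 72 * δ ^ 2 ≤ volume.real (TA i) then lam * δ ^ 2 else 0)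
            + lam * δ ^ 2 / 72 := by
        intro i hi
        split_ifs with hif
        · have h2 : volume.real (TA i) ≤ volume.real (T i ∩ E) :=
            measureReal_mono (inter_subset_inter_right _ (hAE _))
              (ne_top_of_le_ne_top hEf (measure_mono inter_subset_right))
          have h3 : w i * volume.real (TA i) ≤ w i * volume.real (T i ∩ E) :=
            mul_le_mul_of_nonneg_left h2 (hw0 i)
          rw [hws i hi] at h3
          have : 0 ≤ lam * δ ^ 2 / 72 := by positivity
          linarith
        · push Not at hif
          have h3 : w i * volume.real (TA i) ≤ 1 * volume.real (TA i) :=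
            mul_le_mul_of_nonneg_right (hw1 i) measureReal_nonneg
          linarith
      have h2 := hcase.trans (Finset.sum_le_sum h1)
      rw [Finset.sum_add_distrib, ← Finset.sum_filter, Finset.sum_const, Finset.sum_const,
        nsmul_eq_mul, nsmul_eq_mul] at h2
      have h3 : 0 < lam * δ ^ 2 := by positivity
      have h4 : (I.card : ℝ) / 72 * (lam * δ ^ 2) ≤ G.card * (lam * δ ^ 2) := by
        have : ((G.card : ℕ) : ℝ) = (((I.filter fun i => lam / 72 * δ ^ 2
          ≤ volume.real (TA i)).card : ℕ) : ℝ) := rfl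
        rw [this]; linarith
      exact le_of_mul_le_mul_right h4 h3
    have hn := narrowStep hρ hδ hK G a u hE hEf (lam := lam / 72) (by positivity)
      (hsep.mono hGI) (fun i => cell ρ (u i)) (fun i _ => rfl) A hA hAE hov
      (fun i hi => (Finset.mem_filter.1 hi).2)
    refine le_trans ?_ hn
    gcongr
  · right
    have hg : (I.card : ℝ) * (lam * δ ^ 2) / 2 ≤ ∫ x in E, Eb.indicator f x := by linarith
    have hg2eq : ∀ x, Eb.indicator f x ^ 2 = Eb.indicator (fun x => f x ^ 2) x := by
      intro x
      by_cases hx : x ∈ Eb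
      · rw [indicator_of_mem hx, indicator_of_mem hx]
      · rw [indicator_of_notMem hx, indicator_of_notMem hx]; norm_num
    have hf2int : Integrable (fun x => f x ^ 2) (volume.restrict E) := by
      simp only [f, cnt_sq]
      exact cnt_integrable _ _ _ hTT
    have hg2int : Integrable (fun x => Eb.indicator f x ^ 2) (volume.restrict E) := by
      simp only [hg2eq]
      exact hf2int.indicator hEb
    have hBint : Integrable B (volume.restrict E) := cnt_integrable _ _ _ hTT
    have hcs := cs_int (volume.restrict E) (Eb.indicator f) hgint hg2int
    rw [measureReal_restrict_apply_univ] at hcs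
    have hg2B : ∫ x in E, Eb.indicator f x ^ 2 ≤ 2 * ∫ x in E, B x := by
      rw [← integral_const_mul]
      apply integral_mono hg2int (hBint.const_mul _)
      intro x
      dsimp only
      rw [hg2eq]
      by_cases hx : x ∈ Eb
      · rw [indicator_of_mem hx]; exact hx
      · rw [indicator_of_notMem hx]; linarith [hB0 x]
    let H : ι → Finset ι := fun j => I.filter fun i => ρ ≤ ‖u i - u j‖ ∧ (T i ∩ T j).Nonempty
    set D := 160000 / ρ ^ 2 * L * volume.real E with hD
    have hH : ∀ j ∈ I, ((H j).card : ℝ) * (lam ^ 2 * δ ^ 2) ≤ D := by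
      intro j hj
      have hHI : H j ⊆ I := Finset.filter_subset _ _
      exact hairbrush (H j) a u hδ hδ1 hρ hρ1 hlam (fun i hi => hu i (hHI hi)) (hsep.mono hHI)
        hE hEf (fun i hi => hnc i (hHI hi)) (a j) (u j) (hu j hj)
        (fun i hi => (Finset.mem_filter.1 hi).2.1) (fun i hi => (Finset.mem_filter.1 hi).2.2)
    have hBI : ∫ x in E, B x ≤ I.card * (D / (lam ^ 2 * δ ^ 2) * (16 * δ ^ 3 / ρ)) := by
      simp only [B]
      rw [cnt_integral _ _ _ hTT, Finset.sum_filter, Finset.sum_product_right, ← nsmul_eq_mul]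
      apply Finset.sum_le_card_nsmul
      intro j hj
      calc ∑ i ∈ I, (if ρ ≤ ‖u i - u j‖ then
              w i * w j * (volume.restrict E).real (T i ∩ T j) else 0)
          ≤ ∑ i ∈ I, (if ρ ≤ ‖u i - u j‖ ∧ (T i ∩ T j).Nonempty then 16 * δ ^ 3 / ρ else 0) := by
            apply Finset.sum_le_sum
            intro i _
            by_cases h1 : ρ ≤ ‖u i - u j‖
            · by_cases h2 : (T i ∩ T j).Nonempty
              · rw [if_pos h1, if_pos ⟨h1, h2⟩, measureReal_restrict_apply ((hT i).inter (hT j))]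
                have h3 : volume.real (T i ∩ T j ∩ E) ≤ 16 * δ ^ 3 / ρ := by
                  apply MT_inter (a i) (u i) (a j) (u j) hδ.le hρ _
                    (((hT i).inter (hT j)).inter hE) inter_subset_left
                  rw [Prod.norm_def, le_max_iff] at h1
                  exact h1
                have h4 : w i * w j ≤ 1 := mul_le_one₀ (hw1 i) (hw0 j) (hw1 j)
                calc w i * w j * volume.real (T i ∩ T j ∩ E)
                    ≤ 1 * volume.real (T i ∩ T j ∩ E) :=
                      mul_le_mul_of_nonneg_right h4 measureReal_nonneg
                  _ ≤ _ := by rw [one_mul]; exact h3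
              · rw [if_pos h1, if_neg (fun h => h2 h.2)]
                rw [Set.not_nonempty_iff_eq_empty] at h2
                rw [h2]; simp
            · rw [if_neg h1, if_neg (fun h => h1 h.1)]
        _ = (H j).card * (16 * δ ^ 3 / ρ) := by
            rw [← Finset.sum_filter, Finset.sum_const, nsmul_eq_mul]
        _ ≤ D / (lam ^ 2 * δ ^ 2) * (16 * δ ^ 3 / ρ) := by
            have : ((H j).card : ℝ) ≤ D / (lam ^ 2 * δ ^ 2) := by
              rw [le_div_iff₀ (by positivity)]; exact hH j hj
            gcongr
    rcases Nat.eq_zero_or_pos I.card with h0 | h0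
    · rw [h0]; simp; positivity
    have hc0 : (0 : ℝ) < I.card := by exact_mod_cast h0
    have hE0 : 0 ≤ volume.real E := measureReal_nonneg
    have hfin : ((I.card : ℝ) * (lam * δ ^ 2) / 2) ^ 2
        ≤ volume.real E * (2 * (I.card * (D / (lam ^ 2 * δ ^ 2) * (16 * δ ^ 3 / ρ)))) := by
      refine (pow_le_pow_left₀ (by positivity) hg 2).trans (hcs.trans ?_)
      apply mul_le_mul_of_nonneg_left _ hE0
      linarith
    have hpos : 0 < (I.card : ℝ) * δ / (4 * lam ^ 2) := by positivity
    refine le_of_mul_le_mul_left ?_ hpos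
    calc (I.card : ℝ) * δ / (4 * lam ^ 2) * ((I.card : ℝ) * (lam ^ 4 * δ ^ 3))
        = ((I.card : ℝ) * (lam * δ ^ 2) / 2) ^ 2 := by field_simp; ring
      _ ≤ _ := hfin
      _ = _ := by rw [hD]; field_simp; ring


lemma kp_lam_le {ι : Type} {δ lam : ℝ} (hδ : 0 < δ) {I : Finset ι} {a u : ι → ℝ × ℝ}
    {E : Set ((ℝ × ℝ) × ℝ)} (hE : MeasurableSet E)
    (hI : ∀ i ∈ I, lam * δ ^ 2 ≤ volume.real (MT (a i) (u i) δ ∩ E)) (hne : I.Nonempty) :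
    lam ≤ 8 := by
  obtain ⟨i, hi⟩ := hne
  have h1 := hI i hi
  have h2 := MT_vol (a i) (u i) hδ.le ((MT_meas (a i) (u i) δ).inter hE) inter_subset_left
  have h3 : 0 < δ ^ 2 := by positivity
  by_contra hcon
  push Not at hcon
  nlinarith

lemma kp_base {ι : Type} {ε c δ ρ : ℝ} (hε : 0 < ε) (hρ : 0 < ρ) (hρδ : ρ ≤ δ)
    (hδ1 : δ ≤ 1) (hc0 : 0 < c) (hc : c * (1024 / ρ ^ 2) ≤ 1) : KP ι ε c δ := by
  intro I a u E lam hE hEf hlam hu hsep hI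
  have hδ : 0 < δ := hρ.trans_le hρδ
  rcases I.eq_empty_or_nonempty with rfl | hne
  · simp
  have hl8 := kp_lam_le hδ hE hI hne
  have hm := sep_count hδ hsep 0 (zero_le_one) (by simpa using hu)
  have hm1 : (1 : ℝ) ≤ I.card := by exact_mod_cast hne.card_pos
  have hm2 : (I.card : ℝ) ≤ 16 / ρ ^ 2 := by
    refine hm.trans ?_
    have h1 : 2 * 1 / δ + 2 ≤ 4 / ρ := by
      have : 1 / δ ≤ 1 / ρ := one_div_le_one_div_of_le hρ hρδ
      have h2 : 1 ≤ 1 / ρ := by rw [le_div_iff₀ hρ]; linarith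
      have e1 : 2 * 1 / δ = 2 * (1 / δ) := by ring
      have e2 : 4 / ρ = 4 * (1 / ρ) := by ring
      rw [e1, e2]; linarith
    calc (2 * 1 / δ + 2) ^ 2 ≤ (4 / ρ) ^ 2 := by gcongr
      _ = _ := by ring
  have hQ : (I.card : ℝ) ^ (3 / 4 : ℝ) ≤ 16 / ρ ^ 2 := by
    refine le_trans ?_ hm2
    calc (I.card : ℝ) ^ (3 / 4 : ℝ) ≤ (I.card : ℝ) ^ (1 : ℝ) :=
          Real.rpow_le_rpow_of_exponent_le hm1 (by norm_num)
      _ = _ := Real.rpow_one _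
  have hlp : lam ^ (5 / 2 : ℝ) ≤ 64 * lam := by
    have e : lam ^ (5 / 2 : ℝ) = lam * lam ^ (3 / 2 : ℝ) := by
      rw [← Real.rpow_one_add' hlam.le (by norm_num)]; norm_num
    have h2 : lam ^ (3 / 2 : ℝ) ≤ 64 := by
      calc lam ^ (3 / 2 : ℝ) ≤ 8 ^ (3 / 2 : ℝ) := by gcongr
        _ ≤ (8 : ℝ) ^ (2 : ℝ) := Real.rpow_le_rpow_of_exponent_le (by norm_num) (by norm_num)
        _ = 64 := by norm_num
    rw [e]; nlinarith
  have hd : δ ^ ε ≤ 1 := Real.rpow_le_one hδ.le hδ1 hε.le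
  have hEv : lam * δ ^ 2 ≤ volume.real E := by
    obtain ⟨i, hi⟩ := hne
    exact (hI i hi).trans (measureReal_mono inter_subset_right hEf)
  refine le_trans ?_ hEv
  calc c * δ ^ ε * lam ^ (5 / 2 : ℝ) * δ ^ 2 * (I.card : ℝ) ^ (3 / 4 : ℝ)
      ≤ c * 1 * (64 * lam) * δ ^ 2 * (16 / ρ ^ 2) := by gcongr
    _ = (c * (1024 / ρ ^ 2)) * (lam * δ ^ 2) := by ring
    _ ≤ 1 * (lam * δ ^ 2) := by gcongr
    _ = _ := one_mul _

lemma kp_step {ι : Type} {ε c δ ρ : ℝ} (hε : 0 < ε) (hρ : 0 < ρ) (hρ1 : ρ ≤ 1)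
    (hρε : ρ ^ ε = 1 / 10 ^ 9) (hδ : 0 < δ) (hδ1 : δ ≤ 1) (hc0 : 0 < c)
    (hc : c ^ 2 * (64 * (20480000 / ρ ^ 3) * (1 + 10 ^ (2 * ε) / (2 * ε))) ≤ 1)
    (hK : KP ι ε c (δ / ρ)) : KP ι ε c δ := by
  classical
  intro I a u E lam hE hEf hlam hu hsep hI
  rcases I.eq_empty_or_nonempty with rfl | hne
  · simp
  have hl8 := kp_lam_le hδ hE hI hne
  have hm := sep_count hδ hsep 0 (zero_le_one) (by simpa using hu)
  have hm1 : (1 : ℝ) ≤ I.card := by exact_mod_cast hne.card_pos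
  have hm0 : (0 : ℝ) < I.card := by linarith
  have hE0 : 0 ≤ volume.real E := measureReal_nonneg
  have hdr : (δ / ρ) ^ ε = 10 ^ 9 * δ ^ ε := by
    rw [Real.div_rpow hδ.le hρ.le, hρε]; field_simp
  set D := δ ^ ε with hD
  have hD0 : 0 < D := Real.rpow_pos_of_pos hδ _
  have hlp0 : 0 < lam ^ (5 / 2 : ℝ) := Real.rpow_pos_of_pos hlam _
  have hQ0 : 0 < (I.card : ℝ) ^ (3 / 4 : ℝ) := Real.rpow_pos_of_pos hm0 _
  -- comparison of three-quarter powers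
  have hquart : ∀ (x k : ℝ), 1 ≤ k → (I.card : ℝ) ≤ k * x →
      (I.card : ℝ) ^ (3 / 4 : ℝ) ≤ k * x ^ (3 / 4 : ℝ) := by
    intro x k hk hx
    have hx0 : 0 ≤ x := by
      by_contra h; push Not at h; nlinarith
    calc (I.card : ℝ) ^ (3 / 4 : ℝ) ≤ (k * x) ^ (3 / 4 : ℝ) := by gcongr
      _ = k ^ (3 / 4 : ℝ) * x ^ (3 / 4 : ℝ) := Real.mul_rpow (by linarith) hx0
      _ ≤ k ^ (1 : ℝ) * x ^ (3 / 4 : ℝ) := by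
          gcongr
          norm_num
      _ = _ := by rw [Real.rpow_one]
  let P : ι → Prop := fun i => ∃ n : ℤ, lam * δ ^ 2 / 2 ≤
    volume.real (MT (a i) (u i) δ ∩ (E ∩ {p | |p.2 - n * ρ| ≤ ρ}))
  let G := I.filter P
  let B := I.filter (fun i => ¬ P i)
  have hsum : (G.card : ℝ) + B.card = I.card := by
    exact_mod_cast Finset.card_filter_add_card_filter_not (s := I) P
  by_cases hcase : (I.card : ℝ) ≤ 2 * G.card
  · -- concentrated
    let κ : ι → ℤ := fun i => if h : P i then h.choose else 0
    have hG : ∀ i ∈ G, lam * δ ^ 2 / 2 ≤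
        volume.real (MT (a i) (u i) δ ∩ (E ∩ {p | |p.2 - κ i * ρ| ≤ ρ})) := by
      intro i hi
      have h : P i := (Finset.mem_filter.1 hi).2
      simp only [κ, dif_pos h]
      exact h.choose_spec
    have hGI : G ⊆ I := Finset.filter_subset _ _
    have := concStep hρ hρ1 hδ hc0 hK G a u hE hEf hlam (fun i hi => hu i (hGI hi))
      (hsep.mono hGI) κ hG
    rw [hdr] at this
    have hq := hquart _ 2 (by norm_num) hcase
    set g := (G.card : ℝ) ^ (3 / 4 : ℝ) with hg
    have hX : 0 < c * D * lam ^ (5 / 2 : ℝ) * δ ^ 2 := by positivity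
    have h1 : c * D * lam ^ (5 / 2 : ℝ) * δ ^ 2 * (I.card : ℝ) ^ (3 / 4 : ℝ)
      ≤ c * D * lam ^ (5 / 2 : ℝ) * δ ^ 2 * (2 * g) := by gcongr
    have h2 : 10 ^ 9 * (c * D * lam ^ (5 / 2 : ℝ) * δ ^ 2 * g) ≤ 144 * volume.real E := by
      linarith
    linarith
  · push Not at hcase
    have hBI : B ⊆ I := Finset.filter_subset _ _
    have hB2 : (I.card : ℝ) ≤ 2 * B.card := by linarith
    have hnc : ∀ i ∈ B, ∀ t₀ : ℝ, lam * δ ^ 2 / 2 ≤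
        volume.real (MT (a i) (u i) δ ∩ E ∩ {p | ρ / 2 < |p.2 - t₀|}) := by
      intro i hi t₀
      have hP : ¬ P i := (Finset.mem_filter.1 hi).2
      have h1 : volume.real (MT (a i) (u i) δ ∩ (E ∩ {p | |p.2 - (round (t₀ / ρ) : ℤ) * ρ| ≤ ρ}))
          < lam * δ ^ 2 / 2 := by
        by_contra h; push Not at h; exact hP ⟨_, h⟩
      have h2 := hI i (hBI hi)
      have hsub : MT (a i) (u i) δ ∩ E ⊆
          (MT (a i) (u i) δ ∩ (E ∩ {p | |p.2 - (round (t₀ / ρ) : ℤ) * ρ| ≤ ρ})) ∪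
          (MT (a i) (u i) δ ∩ E ∩ {p | ρ / 2 < |p.2 - t₀|}) := by
        rintro p ⟨hp, hpE⟩
        by_cases hh : |p.2 - (round (t₀ / ρ) : ℤ) * ρ| ≤ ρ
        · exact Or.inl ⟨hp, hpE, hh⟩
        · refine Or.inr ⟨⟨hp, hpE⟩, ?_⟩
          push Not at hh
          show ρ / 2 < |p.2 - t₀|
          have hr := abs_sub_round (t₀ / ρ)
          have hr2 : |t₀ - (round (t₀ / ρ) : ℤ) * ρ| ≤ ρ / 2 := by
            have e : t₀ - (round (t₀ / ρ) : ℤ) * ρ = (t₀ / ρ - round (t₀ / ρ)) * ρ := by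
              field_simp
            rw [e, abs_mul, abs_of_pos hρ]
            nlinarith
          have h3 := abs_sub_le p.2 t₀ ((round (t₀ / ρ) : ℤ) * ρ)
          linarith
      have hfin : volume ((MT (a i) (u i) δ ∩ (E ∩ {p | |p.2 - (round (t₀ / ρ) : ℤ) * ρ| ≤ ρ})) ∪
          (MT (a i) (u i) δ ∩ E ∩ {p | ρ / 2 < |p.2 - t₀|})) ≠ ⊤ := by
        refine ne_top_of_le_ne_top hEf (measure_mono ?_)
        rintro p (hp | hp)
        · exact hp.2.1
        · exact hp.1.2
      have h3 := (measureReal_mono hsub hfin).trans (measureReal_union_le _ _)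
      linarith
    rcases broadNarrow hρ hρ1 hδ hδ1 hlam hc0 hK B a u hE hEf (fun i hi => hu i (hBI hi))
      (hsep.mono hBI) (fun i hi => hI i (hBI hi)) hnc with h | h
    · rw [hdr] at h
      have hq := hquart ((B.card : ℝ) / 72) 144 (by norm_num) (by linarith)
      set g := ((B.card : ℝ) / 72) ^ (3 / 4 : ℝ) with hg
      have hl : lam ^ (5 / 2 : ℝ) ≤ 46656 * (lam / 72) ^ (5 / 2 : ℝ) := by
        rw [Real.div_rpow hlam.le (by norm_num)]
        have h72 : (72 : ℝ) ^ (5 / 2 : ℝ) ≤ 46656 := by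
          have e : (72 : ℝ) ^ (5 / 2 : ℝ) = 72 ^ 2 * Real.sqrt 72 := by
            rw [Real.sqrt_eq_rpow, ← Real.rpow_natCast, ← Real.rpow_add (by norm_num)]
            norm_num
          have hs : Real.sqrt 72 ≤ 9 := by
            rw [Real.sqrt_le_left (by norm_num)]; norm_num
          rw [e]; nlinarith
        have hp : (0 : ℝ) < 72 ^ (5 / 2 : ℝ) := by positivity
        rw [← mul_div_assoc, le_div_iff₀ hp]
        nlinarith
      set l := (lam / 72) ^ (5 / 2 : ℝ) with hl'
      have hg0 : 0 ≤ g := by positivity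
      have hl0 : 0 ≤ l := by positivity
      have h1 : c * D * lam ^ (5 / 2 : ℝ) * δ ^ 2 * (I.card : ℝ) ^ (3 / 4 : ℝ)
        ≤ c * D * (46656 * l) * δ ^ 2 * (144 * g) := by gcongr
      have h2 : 10 ^ 9 * (c * D * l * δ ^ 2 * g) ≤ 18 * volume.real E := by linarith
      linarith
    · -- broad
      apply le_of_sq_le_sq _ hE0
      set m := (I.card : ℝ) with hmdef
      have eD : D ^ 2 = δ ^ (2 * ε) := by
        rw [hD, ← Real.rpow_natCast, ← Real.rpow_mul hδ.le]; congr 1; push_cast; ring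
      have el : (lam ^ (5 / 2 : ℝ)) ^ 2 = lam ^ 5 := by
        rw [← Real.rpow_natCast, ← Real.rpow_mul hlam.le, ← Real.rpow_natCast]; norm_num
      have em : (m ^ (3 / 4 : ℝ)) ^ 2 = m * Real.sqrt m := by
        rw [← Real.rpow_natCast, ← Real.rpow_mul hm0.le, Real.sqrt_eq_rpow,
          ← Real.rpow_one_add' hm0.le (by norm_num)]
        norm_num
      have hsm : Real.sqrt m ≤ 4 / δ := by
        rw [Real.sqrt_le_left (by positivity)]
        refine hm.trans ?_
        have h2 : 1 ≤ 1 / δ := by rw [le_div_iff₀ hδ]; linarith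
        have : 2 * 1 / δ + 2 ≤ 4 / δ := by
          have e1 : 2 * 1 / δ = 2 * (1 / δ) := by ring
          have e2 : 4 / δ = 4 * (1 / δ) := by ring
          rw [e1, e2]; linarith
        gcongr
      set L := 1 + Real.log (10 / δ) with hL
      set Cε := 1 + (10 : ℝ) ^ (2 * ε) / (2 * ε) with hCε
      have hLD : D ^ 2 * L ≤ Cε := by
        have h1 := Real.log_le_rpow_div (x := 10 / δ) (by positivity) (show 0 < 2 * ε by linarith)
        rw [Real.div_rpow (by norm_num) hδ.le, ← eD] at h1
        have hd1 : D ^ 2 ≤ 1 := by rw [eD]; exact Real.rpow_le_one hδ.le hδ1 (by linarith)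
        have hd0 : 0 < D ^ 2 := by positivity
        have h2 : D ^ 2 * Real.log (10 / δ) ≤ D ^ 2 * ((10 : ℝ) ^ (2 * ε) / D ^ 2 / (2 * ε)) := by
          gcongr
        have e : D ^ 2 * ((10 : ℝ) ^ (2 * ε) / D ^ 2 / (2 * ε)) = (10 : ℝ) ^ (2 * ε) / (2 * ε) := by
          field_simp
        rw [e] at h2
        rw [hL, hCε, mul_add]; linarith
      calc (c * D * lam ^ (5 / 2 : ℝ) * δ ^ 2 * m ^ (3 / 4 : ℝ)) ^ 2
          = c ^ 2 * D ^ 2 * lam ^ 5 * δ ^ 4 * (m * Real.sqrt m) := by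
            rw [← el, ← em]; ring
        _ ≤ c ^ 2 * D ^ 2 * lam ^ 5 * δ ^ 4 * (m * (4 / δ)) := by gcongr
        _ = c ^ 2 * D ^ 2 * (4 * lam) * (m * (lam ^ 4 * δ ^ 3)) := by field_simp
        _ ≤ c ^ 2 * D ^ 2 * (4 * 8) * ((2 * B.card) * (lam ^ 4 * δ ^ 3)) := by gcongr
        _ = c ^ 2 * D ^ 2 * 64 * (B.card * (lam ^ 4 * δ ^ 3)) := by ring
        _ ≤ c ^ 2 * D ^ 2 * 64 * (20480000 / ρ ^ 3 * L * volume.real E ^ 2) := by gcongr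
        _ = c ^ 2 * 64 * (20480000 / ρ ^ 3) * volume.real E ^ 2 * (D ^ 2 * L) := by ring
        _ ≤ c ^ 2 * 64 * (20480000 / ρ ^ 3) * volume.real E ^ 2 * Cε := by gcongr
        _ = (c ^ 2 * (64 * (20480000 / ρ ^ 3) * Cε)) * volume.real E ^ 2 := by ring
        _ ≤ 1 * volume.real E ^ 2 := by gcongr
        _ = _ := one_mul _

theorem kakeyaKP (ι : Type) {ε : ℝ} (hε : 0 < ε) :
    ∃ c > 0, ∀ δ : ℝ, 0 < δ → δ ≤ 1 → KP ι ε c δ := by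
  set ρ : ℝ := (1 / 10 ^ 9 : ℝ) ^ (1 / ε) with hρdef
  have hρ : 0 < ρ := by positivity
  have hρ1 : ρ < 1 := Real.rpow_lt_one (by norm_num) (by norm_num) (by positivity)
  have hρε : ρ ^ ε = 1 / 10 ^ 9 := by
    rw [hρdef, ← Real.rpow_mul (by norm_num)]
    rw [one_div_mul_cancel hε.ne', Real.rpow_one]
  set Cε := 1 + (10 : ℝ) ^ (2 * ε) / (2 * ε) with hCε
  have hC1 : 1 ≤ Cε := by
    have : 0 ≤ (10 : ℝ) ^ (2 * ε) / (2 * ε) := by positivity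
    linarith
  set K := 64 * (20480000 / ρ ^ 3) * Cε with hKdef
  have hr3 : 1 / ρ ^ 2 ≤ 1 / ρ ^ 3 := by
    apply one_div_le_one_div_of_le (by positivity)
    exact pow_le_pow_of_le_one hρ.le hρ1.le (by norm_num)
  have hr2 : 1 ≤ 1 / ρ ^ 2 := by
    rw [le_div_iff₀ (by positivity), one_mul]; exact pow_le_one₀ hρ.le hρ1.le
  have hK1 : 1024 / ρ ^ 2 ≤ K := by
    have : K = (64 * 20480000) * (1 / ρ ^ 3) * Cε := by rw [hKdef]; ring
    rw [this]
    have e : 1024 / ρ ^ 2 = 1024 * (1 / ρ ^ 2) := by ring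
    rw [e]
    nlinarith
  have hK0 : 1 ≤ K := by
    have e : 1024 / ρ ^ 2 = 1024 * (1 / ρ ^ 2) := by ring
    rw [e] at hK1; linarith
  have hKp : 0 < K := by linarith
  refine ⟨1 / K, by positivity, ?_⟩
  have hind : ∀ k : ℕ, ∀ δ : ℝ, ρ ^ k ≤ δ → δ ≤ 1 → KP ι ε (1 / K) δ := by
    intro k
    have hb : ∀ δ : ℝ, ρ ≤ δ → δ ≤ 1 → KP ι ε (1 / K) δ := fun δ h1 h2 =>
      kp_base hε hρ h1 h2 (by positivity) (by
        rw [one_div_mul_eq_div, div_le_one hKp]; exact hK1)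
    induction k with
    | zero =>
      intro δ h1 h2
      exact hb δ (by rw [pow_zero] at h1; linarith) h2
    | succ k ih =>
      intro δ h1 h2
      rcases le_or_gt ρ δ with h | h
      · exact hb δ h h2
      · have hδ : 0 < δ := lt_of_lt_of_le (by positivity) h1
        refine kp_step hε hρ hρ1.le hρε hδ h2 (by positivity) ?_ (ih (δ / ρ) ?_ ?_)
        · rw [← hCε, ← hKdef]
          have : (1 / K) ^ 2 * K = 1 / K := by field_simp
          rw [this, div_le_one hKp]; exact hK0
        · rw [le_div_iff₀ hρ, ← pow_succ]; exact h1
        · rw [div_le_one hρ]; exact h.le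
  intro δ hδ hδ1
  obtain ⟨k, hk⟩ := exists_pow_lt_of_lt_one hδ hρ1
  exact hind k δ hk.le hδ1


abbrev E3 := EuclideanSpace ℝ (Fin 3)

/-- coordinates with the `k`-th one last -/
def Phi (k : Fin 3) : E3 ≃ᵐ (ℝ × ℝ) × ℝ :=
  (MeasurableEquiv.toLp 2 (Fin 3 → ℝ)).symm.trans
    ((MeasurableEquiv.piFinSuccAbove (fun _ => ℝ) k).trans
      (MeasurableEquiv.prodComm.trans
        (MeasurableEquiv.prodCongr MeasurableEquiv.finTwoArrow (MeasurableEquiv.refl ℝ))))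

lemma Phi_apply (k : Fin 3) (x : E3) :
    Phi k x = ((x (k.succAbove 0), x (k.succAbove 1)), x k) := rfl

lemma Phi_mp (k : Fin 3) : MeasurePreserving (Phi k) volume volume := by
  have h1 := EuclideanSpace.volume_preserving_symm_measurableEquiv_toLp (Fin 3)
  have h2 := volume_preserving_piFinSuccAbove (fun _ : Fin 3 => ℝ) k
  have h3 : MeasurePreserving (MeasurableEquiv.prodComm : ℝ × (Fin 2 → ℝ) ≃ᵐ _) volume volume :=
    Measure.measurePreserving_swap
  have h4 : MeasurePreserving (MeasurableEquiv.prodCongr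
      (MeasurableEquiv.finTwoArrow : (Fin 2 → ℝ) ≃ᵐ ℝ × ℝ) (MeasurableEquiv.refl ℝ))
      volume volume :=
    (volume_preserving_finTwoArrow ℝ).prod (MeasurePreserving.id volume)
  exact ((h1.trans h2).trans h3).trans h4

lemma norm_le_of_coord {x : E3} {r : ℝ} (h : ∀ l, |x l| ≤ r) : ‖x‖ ≤ 2 * r := by
  have hr : 0 ≤ r := (abs_nonneg _).trans (h 0)
  rw [EuclideanSpace.norm_eq, Real.sqrt_le_left (by positivity), Fin.sum_univ_three]
  simp only [Real.norm_eq_abs]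
  have := fun l => pow_le_pow_left₀ (abs_nonneg _) (h l) 2
  nlinarith [this 0, this 1, this 2]

lemma coord_le_norm (x : E3) (l : Fin 3) : |x l| ≤ ‖x‖ := PiLp.norm_apply_le x l

/-- `k` is a dominating coordinate of the unit vector `ξ` -/
def Dom (k : Fin 3) (ξ : E3) : Prop := ‖ξ‖ = 1 ∧ ∀ l, |ξ l| ≤ |ξ k|

lemma Dom.half {k : Fin 3} {ξ : E3} (h : Dom k ξ) : 1 / 2 ≤ |ξ k| := by
  by_contra hcon
  push Not at hcon
  have h1 := h.1
  have h2 : ‖ξ‖ ^ 2 = 1 := by rw [h1]; norm_num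
  rw [EuclideanSpace.norm_sq_eq, Fin.sum_univ_three] at h2
  simp only [Real.norm_eq_abs] at h2
  have := fun l => pow_le_pow_left₀ (abs_nonneg _) (h.2 l) 2
  nlinarith [this 0, this 1, this 2, abs_nonneg (ξ k)]

/-- slope -/
def slope3 (k : Fin 3) (ξ : E3) : ℝ × ℝ :=
  (ξ (k.succAbove 0) / ξ k, ξ (k.succAbove 1) / ξ k)

lemma Dom.ne {k : Fin 3} {ξ : E3} (h : Dom k ξ) : ξ k ≠ 0 := by
  have := h.half
  intro h0; rw [h0] at this; norm_num at this

lemma Dom.slope {k : Fin 3} {ξ : E3} (h : Dom k ξ) : ‖slope3 k ξ‖ ≤ 1 := by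
  have h0 : 0 < |ξ k| := abs_pos.2 h.ne
  rw [slope3, Prod.norm_def, max_le_iff]
  simp only [Real.norm_eq_abs, abs_div]
  exact ⟨(div_le_one h0).2 (h.2 _), (div_le_one h0).2 (h.2 _)⟩

/-- centre in slope coordinates -/
def centre3 (k : Fin 3) (ξ a : E3) : ℝ × ℝ := (Phi k a).1 - a k • slope3 k ξ

lemma tube_sub_MT {k : Fin 3} {ξ a x : E3} {δ : ℝ} (h : Dom k ξ) (hx : x ∈ tube 3 δ ξ a)
    (hx1 : x ∈ ball (0 : E3) 1) : Phi k x ∈ MT (centre3 k ξ a) (slope3 k ξ) (2 * δ) := by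
  obtain ⟨-, h2⟩ := hx
  set s : ℝ := ⟪x - a, ξ⟫
  set w := (x - a) - s • ξ with hw
  have hc := fun l => (coord_le_norm w l).trans h2
  have h0 : 0 < |ξ k| := abs_pos.2 h.ne
  have e : ∀ l, w l = x l - a l - s * ξ l := by intro l; simp [hw]
  have key : ∀ l, |x l - (a l - a k * (ξ l / ξ k)) - x k * (ξ l / ξ k)| ≤ 2 * δ := by
    intro l
    have hr : |ξ l / ξ k| ≤ 1 := by rw [abs_div]; exact (div_le_one h0).2 (h.2 _)
    have e2 : x l - (a l - a k * (ξ l / ξ k)) - x k * (ξ l / ξ k)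
        = w l - w k * (ξ l / ξ k) := by
      rw [e, e]; have := h.ne; field_simp; ring
    rw [e2]
    calc |w l - w k * (ξ l / ξ k)| ≤ |w l| + |w k * (ξ l / ξ k)| := abs_sub _ _
      _ ≤ δ + δ * 1 := by
        rw [abs_mul]
        have := hc l; have := hc k
        gcongr
        exact (abs_nonneg _).trans this
      _ = _ := by ring
  refine ⟨?_, ?_⟩
  · rw [Prod.norm_def, max_le_iff]
    exact ⟨key _, key _⟩
  · rw [mem_ball_zero_iff] at hx1
    exact (coord_le_norm x k).trans hx1.le

lemma abs_inner_unit {ξ V : E3} (h : ‖ξ‖ = 1) : |⟪V, ξ⟫| ≤ ‖V‖ := by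
  have := abs_real_inner_le_norm V ξ
  rwa [h, mul_one] at this

lemma sub_tube {k : Fin 3} {ξ a x : E3} {δ : ℝ} (hδ1 : δ ≤ 1 / 4)
    (h : Dom k ξ) (ht : |x k - a k| ≤ 1 / 8)
    (hv : ∀ l, |x l - a l - (x k - a k) * (ξ l / ξ k)| ≤ δ / 4) : x ∈ tube 3 δ ξ a := by
  set t := x k - a k with htdef
  set V := (x - a) - (t / ξ k) • ξ with hV
  have hVn : ‖V‖ ≤ δ / 2 := by
    have := norm_le_of_coord (x := V) (r := δ / 4) (fun l => by
      have e : V l = x l - a l - t * (ξ l / ξ k) := by simp [hV]; ring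
      rw [e]; exact hv l)
    linarith
  have hxa : x - a = (t / ξ k) • ξ + V := by rw [hV]; abel
  have hin : ⟪x - a, ξ⟫ = t / ξ k + ⟪V, ξ⟫ := by
    rw [hxa, inner_add_left, real_inner_smul_left, real_inner_self_eq_norm_sq, h.1]; ring
  have hVi := abs_inner_unit (V := V) h.1
  have htk : |t / ξ k| ≤ 1 / 4 := by
    rw [abs_div, div_le_iff₀ (abs_pos.2 h.ne)]
    have := h.half; linarith
  refine ⟨?_, ?_⟩
  · rw [hin]
    exact (abs_add_le _ _).trans (by linarith)
  · rw [hin]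
    have e : x - a - (t / ξ k + ⟪V, ξ⟫) • ξ = V - ⟪V, ξ⟫ • ξ := by
      rw [hV, add_smul]; abel
    rw [e]
    refine (norm_sub_le _ _).trans ?_
    rw [norm_smul, h.1, Real.norm_eq_abs]; linarith

lemma tube_vol {k : Fin 3} {ξ a : E3} {δ : ℝ} (hδ : 0 < δ) (hδ1 : δ ≤ 1 / 4) (h : Dom k ξ) :
    ENNReal.ofReal (δ ^ 2 / 16) ≤ volume (tube 3 δ ξ a) := by
  set B : Set ((ℝ × ℝ) × ℝ) :=
    {p | ‖p.1 - (Phi k a).1 - (p.2 - a k) • slope3 k ξ‖ ≤ δ / 4 ∧ |p.2 - a k| ≤ 1 / 8} with hB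
  have hBm : MeasurableSet B := by
    have m1 : Measurable fun p : (ℝ × ℝ) × ℝ =>
      ‖p.1 - (Phi k a).1 - (p.2 - a k) • slope3 k ξ‖ := by fun_prop
    have m2 : Measurable fun p : (ℝ × ℝ) × ℝ => |p.2 - a k| := by fun_prop
    exact (measurableSet_le m1 measurable_const).inter (measurableSet_le m2 measurable_const)
  have hsub : Phi k ⁻¹' B ⊆ tube 3 δ ξ a := by
    rintro x ⟨h1, h2⟩
    rw [Prod.norm_def, max_le_iff] at h1
    refine sub_tube hδ1 h h2 ?_
    rw [k.forall_iff_succAbove]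
    refine ⟨?_, ?_⟩
    · rw [div_self h.ne]; simp; linarith
    · intro i
      fin_cases i
      · exact h1.1
      · exact h1.2
  refine le_trans ?_ (measure_mono hsub)
  rw [(Phi_mp k).measure_preimage hBm.nullMeasurableSet]
  rw [Measure.volume_eq_prod, Measure.prod_apply_symm hBm]
  calc ENNReal.ofReal (δ ^ 2 / 16)
      = ∫⁻ y, (closedBall (a k) (1 / 8)).indicator
          (fun _ => ENNReal.ofReal (4 * (δ / 4) ^ 2)) y := by
        rw [lintegral_indicator measurableSet_closedBall]
        simp only [lintegral_const, Measure.restrict_apply MeasurableSet.univ, univ_inter,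
          Real.volume_closedBall]
        rw [← ENNReal.ofReal_mul (by positivity)]
        congr 1; ring
    _ ≤ _ := by
        apply lintegral_mono
        intro y
        by_cases hy : y ∈ closedBall (a k) (1 / 8)
        · rw [indicator_of_mem hy, ← vol_ball2 ((Phi k a).1 + (y - a k) • slope3 k ξ)
            (by positivity)]
          apply measure_mono
          intro q hq
          rw [mem_closedBall, dist_eq_norm] at hq
          rw [mem_closedBall, Real.dist_eq] at hy
          refine ⟨?_, hy⟩
          show ‖q - (Phi k a).1 - (y - a k) • slope3 k ξ‖ ≤ δ / 4
          rwa [sub_sub]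
        · rw [indicator_of_notMem hy]; exact zero_le

/-- a tube witnessing a large value of the maximal function -/
lemma exists_tube {k : Fin 3} {ξ : E3} {δ lam : ℝ} (hδ : 0 < δ) (hδ1 : δ ≤ 1 / 4)
    (hlam : 0 < lam) (h : Dom k ξ) {E : Set E3} (hE : MeasurableSet E) (hE1 : E ⊆ ball 0 1)
    (hk : ENNReal.ofReal lam ≤ kakeyaMax 3 δ (E.indicator fun _ => (1 : ℝ)) ξ) :
    ∃ b : ℝ × ℝ, (lam / 128) * (2 * δ) ^ 2 ≤
      volume.real (MT b (slope3 k ξ) (2 * δ) ∩ (Phi k).symm ⁻¹' E) := by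
  have h1 : ENNReal.ofReal (lam / 2) < kakeyaMax 3 δ (E.indicator fun _ => (1 : ℝ)) ξ :=
    lt_of_lt_of_le ((ENNReal.ofReal_lt_ofReal_iff hlam).2 (by linarith)) hk
  rw [kakeyaMax, lt_iSup_iff] at h1
  obtain ⟨a, ha⟩ := h1
  have h2 := ENNReal.mul_le_of_le_div ha.le
  have h3 : (∫⁻ x in tube 3 δ ξ a, ENNReal.ofReal |E.indicator (fun _ => (1 : ℝ)) x|)
      = volume (E ∩ tube 3 δ ξ a) := by
    have : (fun x => ENNReal.ofReal |E.indicator (fun _ => (1 : ℝ)) x|)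
        = E.indicator (fun _ => (1 : ℝ≥0∞)) := by
      ext x
      by_cases hx : x ∈ E <;> simp [hx]
    rw [this, lintegral_indicator hE, setLIntegral_const, one_mul, Measure.restrict_apply hE]
  rw [h3] at h2
  refine ⟨centre3 k ξ a, ?_⟩
  set F := MT (centre3 k ξ a) (slope3 k ξ) (2 * δ) ∩ (Phi k).symm ⁻¹' E with hF
  have hFm : MeasurableSet F := (MT_meas _ _ _).inter ((Phi k).symm.measurable hE)
  have h4 : volume (E ∩ tube 3 δ ξ a) ≤ volume F := by
    rw [← (Phi_mp k).measure_preimage hFm.nullMeasurableSet]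
    apply measure_mono
    rintro x ⟨hxE, hxT⟩
    refine ⟨tube_sub_MT h hxT (hE1 hxE), ?_⟩
    show (Phi k).symm (Phi k x) ∈ E
    rwa [MeasurableEquiv.symm_apply_apply]
  have hFt : volume F ≠ ⊤ := by
    refine ne_top_of_le_ne_top ?_ (measure_mono inter_subset_right)
    rw [(Phi_mp k).symm.measure_preimage hE.nullMeasurableSet]
    exact ne_top_of_le_ne_top measure_ball_lt_top.ne (measure_mono hE1)
  have h5 : ENNReal.ofReal ((lam / 128) * (2 * δ) ^ 2) ≤ volume F := by
    calc ENNReal.ofReal ((lam / 128) * (2 * δ) ^ 2)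
        = ENNReal.ofReal (lam / 2) * ENNReal.ofReal (δ ^ 2 / 16) := by
          rw [← ENNReal.ofReal_mul (by positivity)]; congr 1; ring
      _ ≤ ENNReal.ofReal (lam / 2) * volume (tube 3 δ ξ a) := by
          gcongr; exact tube_vol hδ hδ1 h
      _ ≤ _ := h2.trans h4
  exact (ENNReal.ofReal_le_iff_le_toReal hFt).1 h5

/-- lift of slopes -/
def lift3 (k : Fin 3) (v : ℝ × ℝ) : E3 := (Phi k).symm (v, 1)

lemma lift3_k (k : Fin 3) (v : ℝ × ℝ) : lift3 k v k = 1 := by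
  have := (Phi k).apply_symm_apply (v, 1)
  rw [Phi_apply] at this
  exact (Prod.ext_iff.1 this).2

lemma lift3_01 (k : Fin 3) (v : ℝ × ℝ) : lift3 k v (k.succAbove 0) = v.1 ∧
    lift3 k v (k.succAbove 1) = v.2 := by
  have := (Phi k).apply_symm_apply (v, 1)
  rw [Phi_apply] at this
  exact Prod.ext_iff.1 (Prod.ext_iff.1 this).1

lemma lift3_lip (k : Fin 3) (v w : ℝ × ℝ) : ‖lift3 k v - lift3 k w‖ ≤ 2 * ‖v - w‖ := by
  apply norm_le_of_coord
  rw [k.forall_iff_succAbove]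
  refine ⟨?_, ?_⟩
  · simp [lift3_k]
  · intro i
    fin_cases i
    · have := norm_fst_le (v - w)
      simpa [(lift3_01 k v).1, (lift3_01 k w).1] using this
    · have := norm_snd_le (v - w)
      simpa [(lift3_01 k v).2, (lift3_01 k w).2] using this

lemma lift3_norm (k : Fin 3) (v : ℝ × ℝ) : 1 ≤ ‖lift3 k v‖ := by
  have := coord_le_norm (lift3 k v) k
  rwa [lift3_k, abs_one] at this

/-- radial projection of the lift -/
def proj3 (k : Fin 3) (s : ℝ) (v : ℝ × ℝ) : E3 := (s * ‖lift3 k v‖⁻¹) • lift3 k v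

lemma proj3_lip (k : Fin 3) {s : ℝ} (hs : |s| = 1) : LipschitzWith 4 (proj3 k s) := by
  apply LipschitzWith.of_dist_le_mul
  intro v w
  rw [dist_eq_norm, dist_eq_norm]
  set x := lift3 k v
  set y := lift3 k w
  have hx : 1 ≤ ‖x‖ := lift3_norm k v
  have hy : 1 ≤ ‖y‖ := lift3_norm k w
  have hxy : ‖x - y‖ ≤ 2 * ‖v - w‖ := lift3_lip k v w
  have e : proj3 k s v - proj3 k s w
      = (s * ‖x‖⁻¹) • (x - y) + (s * ‖x‖⁻¹ * (‖y‖ - ‖x‖) * ‖y‖⁻¹) • y := by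
    have : s * ‖y‖⁻¹ = s * ‖x‖⁻¹ - (s * ‖x‖⁻¹ * (‖y‖ - ‖x‖) * ‖y‖⁻¹) := by
      field_simp; ring
    show (s * ‖x‖⁻¹) • x - (s * ‖y‖⁻¹) • y = _
    rw [this, sub_smul, smul_sub]; abel
  have hx' : ‖x‖⁻¹ ≤ 1 := inv_le_one_of_one_le₀ hx
  have h1 : ‖(s * ‖x‖⁻¹) • (x - y)‖ ≤ ‖x - y‖ := by
    rw [norm_smul, norm_mul, Real.norm_eq_abs, hs, norm_inv, norm_norm]
    nlinarith [norm_nonneg (x - y)]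
  have h2 : ‖(s * ‖x‖⁻¹ * (‖y‖ - ‖x‖) * ‖y‖⁻¹) • y‖ ≤ ‖x - y‖ := by
    rw [norm_smul, norm_mul, norm_mul, norm_mul, Real.norm_eq_abs, hs, norm_inv, norm_norm,
      norm_inv, norm_norm, mul_assoc, inv_mul_cancel₀ (by positivity), mul_one, one_mul]
    have : ‖‖y‖ - ‖x‖‖ ≤ ‖x - y‖ := by
      rw [Real.norm_eq_abs, norm_sub_rev]; exact abs_norm_sub_norm_le y x
    nlinarith [norm_nonneg (‖y‖ - ‖x‖)]
  rw [e]
  refine (norm_add_le _ _).trans ?_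
  push_cast
  linarith

lemma proj3_slope {k : Fin 3} {ξ : E3} (h : Dom k ξ) :
    ξ = proj3 k 1 (slope3 k ξ) ∨ ξ = proj3 k (-1) (slope3 k ξ) := by
  have hne := h.ne
  have e : lift3 k (slope3 k ξ) = (ξ k)⁻¹ • ξ := by
    ext l
    revert l
    rw [k.forall_iff_succAbove]
    refine ⟨?_, ?_⟩
    · rw [lift3_k]; simp [hne]
    · intro i
      fin_cases i
      · refine (lift3_01 k _).1.trans ?_
        simp [slope3]; ring
      · refine (lift3_01 k _).2.trans ?_
        simp [slope3]; ring
  have hn : ‖lift3 k (slope3 k ξ)‖⁻¹ = |ξ k| := by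
    rw [e, norm_smul, h.1, mul_one, norm_inv, inv_inv, Real.norm_eq_abs]
  unfold proj3
  rw [hn, e]
  rcases abs_choice (ξ k) with h' | h' <;> rw [h'] <;> simp [hne]

lemma patch_measure (k : Fin 3) (v : ℝ × ℝ) {δ : ℝ} (hδ : 0 < δ) :
    μH[2] {ξ : E3 | Dom k ξ ∧ ‖slope3 k ξ - v‖ ≤ 2 * δ} ≤ ENNReal.ofReal (512 * δ ^ 2) := by
  have hb : ∀ s : ℝ, |s| = 1 → μH[2] (proj3 k s '' closedBall v (2 * δ))
      ≤ ENNReal.ofReal (256 * δ ^ 2) := by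
    intro s hs
    refine ((proj3_lip k hs).hausdorffMeasure_image_le (d := 2) (by norm_num) _).trans ?_
    rw [hausdorffMeasure_prod_real, vol_ball2 _ (by positivity)]
    have : (((4 : NNReal) : ℝ≥0∞)) ^ (2 : ℝ) = ENNReal.ofReal 16 := by
      rw [ENNReal.rpow_ofNat]; norm_num
    rw [this, ← ENNReal.ofReal_mul (by norm_num)]
    apply ENNReal.ofReal_le_ofReal; linarith
  have hsub : {ξ : E3 | Dom k ξ ∧ ‖slope3 k ξ - v‖ ≤ 2 * δ} ⊆
      proj3 k 1 '' closedBall v (2 * δ) ∪ proj3 k (-1) '' closedBall v (2 * δ) := by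
    rintro ξ ⟨h1, h2⟩
    have h3 : slope3 k ξ ∈ closedBall v (2 * δ) := by rwa [mem_closedBall, dist_eq_norm]
    rcases proj3_slope h1 with h | h
    · exact Or.inl ⟨_, h3, h.symm⟩
    · exact Or.inr ⟨_, h3, h.symm⟩
  refine (measure_mono hsub).trans ((measure_union_le _ _).trans ?_)
  refine (add_le_add (hb 1 (by simp)) (hb (-1) (by simp))).trans ?_
  rw [← ENNReal.ofReal_add (by positivity) (by positivity)]
  apply ENNReal.ofReal_le_ofReal; linarith


lemma cap_measure {k : Fin 3} {ε c δ lam : ℝ} (hε : 0 < ε) (hδ : 0 < δ) (hδ1 : δ ≤ 1 / 4)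
    (hlam : 0 < lam) (hc : 0 < c) (hK : KP E3 ε c (2 * δ))
    {E : Set E3} (hE : MeasurableSet E) (hE1 : E ⊆ ball 0 1) :
    μH[2] {ξ : E3 | Dom k ξ ∧
        ENNReal.ofReal lam ≤ kakeyaMax 3 δ (E.indicator fun _ => (1 : ℝ)) ξ} ≤
      ENNReal.ofReal (512 * ((128 ^ (5 / 2 : ℝ) / c) *
        (lam ^ (-(5 / 2) : ℝ) * δ ^ (-(1 / 2 : ℝ) - ε) * volume.real E)) ^ (4 / 3 : ℝ)) := by
  classical
  set Ω : Set E3 := {ξ : E3 | Dom k ξ ∧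
        ENNReal.ofReal lam ≤ kakeyaMax 3 δ (E.indicator fun _ => (1 : ℝ)) ξ} with hΩ
  have h2δ : 0 < 2 * δ := by linarith
  obtain ⟨S, hSΩ, hSs, hSc⟩ := exists_max_sep Ω (slope3 k) h2δ ⌊(2 * 1 / (2 * δ) + 2) ^ 2⌋₊
    (fun S hS hs => Nat.le_floor (sep_count h2δ hs 0 zero_le_one
      (fun i hi => by simpa using (hS hi).1.slope)))
  have hb : ∀ ξ : E3, ∃ b : ℝ × ℝ, ξ ∈ Ω → (lam / 128) * (2 * δ) ^ 2 ≤
      volume.real (MT b (slope3 k ξ) (2 * δ) ∩ (Phi k).symm ⁻¹' E) := by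
    intro ξ
    by_cases h : ξ ∈ Ω
    · obtain ⟨b, hb⟩ := exists_tube hδ hδ1 hlam h.1 hE hE1 h.2
      exact ⟨b, fun _ => hb⟩
    · exact ⟨0, fun h' => absurd h' h⟩
  choose b hb using hb
  have hEt : volume E ≠ ⊤ := ne_top_of_le_ne_top measure_ball_lt_top.ne (measure_mono hE1)
  have hEv : volume ((Phi k).symm ⁻¹' E) = volume E :=
    (Phi_mp k).symm.measure_preimage hE.nullMeasurableSet
  have hkp := hK S b (slope3 k) ((Phi k).symm ⁻¹' E) (lam / 128) ((Phi k).symm.measurable hE)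
    (by rw [hEv]; exact hEt) (by positivity) (fun i hi => (hSΩ hi).1.slope) hSs
    (fun i hi => hb i (hSΩ hi))
  have hEv' : volume.real ((Phi k).symm ⁻¹' E) = volume.real E := by
    simp only [measureReal_def, hEv]
  rw [hEv'] at hkp
  set V := volume.real E with hV
  have hV0 : 0 ≤ V := measureReal_nonneg
  set m : ℝ := (S.card : ℝ) with hm
  have hm0 : 0 ≤ m := by positivity
  -- covering
  have hcov : μH[2] Ω ≤ ENNReal.ofReal (512 * (m * δ ^ 2)) := by
    have hsub : Ω ⊆ ⋃ i ∈ S, {ξ : E3 | Dom k ξ ∧ ‖slope3 k ξ - slope3 k i‖ ≤ 2 * δ} := by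
      intro ξ hξ
      obtain ⟨i, hi, hlt⟩ := hSc ξ hξ
      exact mem_iUnion₂.2 ⟨i, hi, hξ.1, hlt.le⟩
    refine (measure_mono hsub).trans ((measure_biUnion_finset_le _ _).trans ?_)
    refine (Finset.sum_le_sum (fun i _ => patch_measure k (slope3 k i) hδ)).trans ?_
    rw [Finset.sum_const, nsmul_eq_mul, ← ENNReal.ofReal_natCast,
      ← ENNReal.ofReal_mul (by positivity)]
    apply ENNReal.ofReal_le_ofReal; rw [← hm]; linarith
  refine hcov.trans (ENNReal.ofReal_le_ofReal ?_)
  gcongr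
  -- numerical part
  have h1 : m ^ (3 / 4 : ℝ) * δ ^ (3 / 2 : ℝ) ≤
      (128 ^ (5 / 2 : ℝ) / c) * (lam ^ (-(5 / 2) : ℝ) * δ ^ (-(1 / 2 : ℝ) - ε) * V) := by
    have hl : 0 < lam ^ (5 / 2 : ℝ) := by positivity
    have hD : 0 < δ ^ ε := by positivity
    have e1 : lam ^ (-(5 / 2) : ℝ) = (lam ^ (5 / 2 : ℝ))⁻¹ := Real.rpow_neg hlam.le _
    have e2 : δ ^ (-(1 / 2 : ℝ) - ε) = δ ^ (3 / 2 : ℝ) / (δ ^ 2 * δ ^ ε) := by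
      rw [← Real.rpow_natCast, ← Real.rpow_add hδ, ← Real.rpow_sub hδ]; congr 1
      push_cast; ring
    have h2 : c * δ ^ ε * (lam / 128) ^ (5 / 2 : ℝ) * δ ^ 2 * m ^ (3 / 4 : ℝ) ≤ V := by
      refine le_trans ?_ hkp
      gcongr <;> linarith
    rw [Real.div_rpow hlam.le (by norm_num)] at h2
    rw [e1, e2]
    have hp : (0 : ℝ) < 128 ^ (5 / 2 : ℝ) := by positivity
    have ht : 0 < δ ^ (3 / 2 : ℝ) := by positivity
    have e3 : (128 ^ (5 / 2 : ℝ) / c) * ((lam ^ (5 / 2 : ℝ))⁻¹ *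
        (δ ^ (3 / 2 : ℝ) / (δ ^ 2 * δ ^ ε)) * V) =
        V / (c * δ ^ ε * (lam ^ (5 / 2 : ℝ) / 128 ^ (5 / 2 : ℝ)) * δ ^ 2) * δ ^ (3 / 2 : ℝ) := by
      field_simp
    rw [e3]
    gcongr
    rw [le_div_iff₀ (by positivity)]
    linarith
  have h3 : m * δ ^ 2 = (m ^ (3 / 4 : ℝ) * δ ^ (3 / 2 : ℝ)) ^ (4 / 3 : ℝ) := by
    rw [Real.mul_rpow (by positivity) (by positivity), ← Real.rpow_mul hm0, ← Real.rpow_mul hδ.le,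
      ← Real.rpow_natCast]
    norm_num
  rw [h3]
  gcongr

/-- **Distributional estimate (2.1).** For every `ε > 0` there exist `C_ε > 0` and `δ₀ > 0`
such that for every `δ ∈ (0,δ₀)`, every measurable `E ⊆ B(0,1) ⊆ ℝ³` and every `λ ∈ [δ,1]`:
`σ({ξ ∈ S² : (χ_E)*_δ(ξ) ≥ λ}) ≤ C_ε (λ^{-5/2} δ^{-1/2-ε} |E|)^{4/3}`. -/
theorem distributional_estimate :
    ∀ ε > (0 : ℝ), ∃ C > (0 : ℝ), ∃ δ₀ > (0 : ℝ), ∀ δ : ℝ, δ ∈ Set.Ioo 0 δ₀ →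
      ∀ E : Set (EuclideanSpace ℝ (Fin 3)), MeasurableSet E → E ⊆ ball 0 1 →
        ∀ lam : ℝ, lam ∈ Set.Icc δ 1 →
          sphereMeasure 3
              {ξ | ENNReal.ofReal lam ≤ kakeyaMax 3 δ (E.indicator fun _ => (1 : ℝ)) ξ} ≤
            ENNReal.ofReal C *
              (ENNReal.ofReal (lam ^ (-(5 / 2) : ℝ) * δ ^ (-(1 / 2 : ℝ) - ε)) * volume E) ^
                (4 / 3 : ℝ) := by
  intro ε hε
  obtain ⟨c, hc, hK⟩ := kakeyaKP E3 hε
  refine ⟨1536 * (128 ^ (5 / 2 : ℝ) / c) ^ (4 / 3 : ℝ), by positivity, 1 / 4, by norm_num, ?_⟩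
  rintro δ ⟨hδ, hδ1⟩ E hE hE1 lam ⟨hl, -⟩
  have hlam : 0 < lam := hδ.trans_le hl
  have hEt : volume E ≠ ⊤ := ne_top_of_le_ne_top measure_ball_lt_top.ne (measure_mono hE1)
  set A : Set E3 := {ξ | ENNReal.ofReal lam ≤ kakeyaMax 3 δ (E.indicator fun _ => (1 : ℝ)) ξ}
    with hA
  have hd : ((3 : ℕ) : ℝ) - 1 = 2 := by norm_num
  rw [sphereMeasure, hd, Measure.restrict_apply' isClosed_sphere.measurableSet]
  have hsub : A ∩ sphere (0 : E3) 1 ⊆ ⋃ k ∈ (Finset.univ : Finset (Fin 3)), {ξ : E3 | Dom k ξ ∧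
        ENNReal.ofReal lam ≤ kakeyaMax 3 δ (E.indicator fun _ => (1 : ℝ)) ξ} := by
    rintro ξ ⟨h1, h2⟩
    obtain ⟨k, -, hk⟩ := Finset.exists_max_image (Finset.univ : Finset (Fin 3))
      (fun l => |ξ l|) Finset.univ_nonempty
    exact mem_iUnion₂.2 ⟨k, Finset.mem_univ _,
      ⟨mem_sphere_zero_iff_norm.1 h2, fun l => hk l (Finset.mem_univ _)⟩, h1⟩
  refine (measure_mono hsub).trans ((measure_biUnion_finset_le _ _).trans ?_)
  refine (Finset.sum_le_sum (fun k _ => cap_measure (k := k) hε hδ hδ1.le hlam hc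
    (hK (2 * δ) (by linarith) (by linarith)) hE hE1)).trans ?_
  set X := lam ^ (-(5 / 2) : ℝ) * δ ^ (-(1 / 2 : ℝ) - ε) with hX
  have hX0 : 0 ≤ X := by positivity
  rw [← ENNReal.ofReal_toReal hEt, ← ENNReal.ofReal_mul hX0,
    ENNReal.ofReal_rpow_of_nonneg (by positivity) (by norm_num),
    ← ENNReal.ofReal_mul (by positivity), Finset.sum_const, nsmul_eq_mul, Finset.card_univ,
    Fintype.card_fin, ← ENNReal.ofReal_natCast, ← ENNReal.ofReal_mul (by positivity)]
  apply ENNReal.ofReal_le_ofReal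
  rw [Real.mul_rpow (by positivity) (by positivity), measureReal_def]
  push_cast
  apply le_of_eq
  ring
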